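/- arXiv:1312.0553 — 2 statements merged into one kernel-verified Lean document; each statement's English description precedes it below -/
import Mathlib

section
/- Let F be a number field with r real places and s complex places, ring of integers 𝔬, and class number h. Set N = 2^r · h. There exist elements a₁, …, a_N ∈ GL₂(F) and a real number δ > 0 such that for every g ∈ GL₂(F_∞) there exist an index 1 ≤ j ≤ N, an invertible scalar matrix z ∈ Z(F_∞), a matrix γ ∈ SL₂(𝔬), an element k ∈ K_∞, an element x ∈ F_∞, and an element y ∈ F_∞ all of whose components (including those at complex places) are real numbers strictly greater than δ, such that g = z · ι(γ) · ι(a_j) · [[y, x], [0, 1]] · k, where ι denotes the entrywise application of the canonical (mixed) embedding of F (resp. of 𝔬 via F) into F_∞. -/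
open NumberField Matrix

/-- `F_∞ = ℝ^r × ℂ^s`, the product of the archimedean completions of `F`,
indexed by the real and complex infinite places. -/
abbrev Finfty (F : Type) [Field F] [NumberField F] : Type :=
  ({w : InfinitePlace F // w.IsReal} → ℝ) × ({w : InfinitePlace F // w.IsComplex} → ℂ)

/-- The component of a matrix over `F_∞` at a real place. -/
noncomputable def cmpR {F : Type} [Field F] [NumberField F]
    (M : Matrix (Fin 2) (Fin 2) (Finfty F)) (w : {w : InfinitePlace F // w.IsReal}) :
    Matrix (Fin 2) (Fin 2) ℝ :=
  Matrix.of fun i j => (M i j).1 w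

/-- The component of a matrix over `F_∞` at a complex place. -/
noncomputable def cmpC {F : Type} [Field F] [NumberField F]
    (M : Matrix (Fin 2) (Fin 2) (Finfty F)) (w : {w : InfinitePlace F // w.IsComplex}) :
    Matrix (Fin 2) (Fin 2) ℂ :=
  Matrix.of fun i j => (M i j).2 w

/-- `k ∈ K_∞`: the component at each real place lies in `SO₂(ℝ)` and at each
complex place in `SU₂(ℂ)`. -/
def InKinfty {F : Type} [Field F] [NumberField F] (k : GL (Fin 2) (Finfty F)) : Prop :=
  (∀ w : {w : InfinitePlace F // w.IsReal},
      (cmpR (k : Matrix (Fin 2) (Fin 2) (Finfty F)) w)ᵀ *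
        cmpR (k : Matrix (Fin 2) (Fin 2) (Finfty F)) w = 1 ∧
      (cmpR (k : Matrix (Fin 2) (Fin 2) (Finfty F)) w).det = 1) ∧
  (∀ w : {w : InfinitePlace F // w.IsComplex},
      (cmpC (k : Matrix (Fin 2) (Fin 2) (Finfty F)) w)ᴴ *
        cmpC (k : Matrix (Fin 2) (Fin 2) (Finfty F)) w = 1 ∧
      (cmpC (k : Matrix (Fin 2) (Fin 2) (Finfty F)) w).det = 1)



/-- Two pairs generating the same nonzero ideal are related by `SL₂`. -/
theorem sl2_transitive {R : Type*} [CommRing R] [IsDedekindDomain R] (u1 u2 v1 v2 : R)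
    (h : Ideal.span {u1, u2} = Ideal.span {v1, v2}) (hne : Ideal.span {u1, u2} ≠ ⊥) :
    ∃ e11 e12 e21 e22 : R, e11 * e22 - e12 * e21 = 1 ∧
      e11 * u1 + e12 * u2 = v1 ∧ e21 * u1 + e22 * u2 = v2 := by
  set I := Ideal.span {u1, u2} with hI
  obtain ⟨a, haI, ha0⟩ := Submodule.exists_mem_ne_zero_of_ne_bot hne
  obtain ⟨J, hJ⟩ := Ideal.dvd_span_singleton.mpr haI
  have key : ∀ w1 w2 : R, I = Ideal.span {w1, w2} → ∃ r ∈ J, ∃ s ∈ J, w1 * s - w2 * r = a := by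
    intro w1 w2 hw
    have : a ∈ I * J := by rw [← hJ]; exact Ideal.mem_span_singleton_self a
    rw [hw, Ideal.span_insert, Ideal.sup_mul, Submodule.mem_sup] at this
    obtain ⟨y, hy, z, hz, hyz⟩ := this
    obtain ⟨s, hs, rfl⟩ := Ideal.mem_span_singleton_mul.mp hy
    obtain ⟨r, hr, rfl⟩ := Ideal.mem_span_singleton_mul.mp hz
    exact ⟨-r, J.neg_mem hr, s, hs, by linear_combination hyz⟩
  obtain ⟨r, hr, s, hs, hu⟩ := key u1 u2 hI
  obtain ⟨r', hr', s', hs', hv⟩ := key v1 v2 h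
  have div : ∀ x ∈ I, ∀ y ∈ J, a ∣ x * y := by
    intro x hx y hy
    rw [← Ideal.mem_span_singleton, hJ]
    exact Ideal.mul_mem_mul hx hy
  have hu1 : u1 ∈ I := Ideal.subset_span (by simp)
  have hu2 : u2 ∈ I := Ideal.subset_span (by simp)
  have hv1 : v1 ∈ I := by rw [h]; exact Ideal.subset_span (by simp)
  have hv2 : v2 ∈ I := by rw [h]; exact Ideal.subset_span (by simp)
  obtain ⟨e11, h11⟩ := dvd_sub (div v1 hv1 s hs) (div u2 hu2 r' hr')
  obtain ⟨e12, h12⟩ := dvd_sub (div u1 hu1 r' hr') (div v1 hv1 r hr)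
  obtain ⟨e21, h21⟩ := dvd_sub (div v2 hv2 s hs) (div u2 hu2 s' hs')
  obtain ⟨e22, h22⟩ := dvd_sub (div u1 hu1 s' hs') (div v2 hv2 r hr)
  refine ⟨e11, e12, e21, e22, ?_, ?_, ?_⟩
  · apply mul_left_cancel₀ (mul_ne_zero ha0 ha0)
    have : a * a * (e11 * e22 - e12 * e21) = (a * e11) * (a * e22) - (a * e12) * (a * e21) := by ring
    rw [this, ← h11, ← h12, ← h21, ← h22]
    linear_combination (v1 * s' - v2 * r') * hu + a * hv
  · apply mul_left_cancel₀ ha0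
    linear_combination (-u1) * h11 - u2 * h12 + v1 * hu
  · apply mul_left_cancel₀ ha0
    linear_combination (-u1) * h21 - u2 * h22 + v2 * hu

/-- Local Gram–Schmidt identity. -/
theorem gram_local {𝕜 : Type*} [RCLike 𝕜] (a b a' b' c d : 𝕜) (hβ : 0 < ‖a'‖ ^ 2 + ‖b'‖ ^ 2) :
    ‖c * a + d * a'‖ ^ 2 + ‖c * b + d * b'‖ ^ 2 =
      ‖c‖ ^ 2 * (‖a * b' - b * a'‖ ^ 2 / (‖a'‖ ^ 2 + ‖b'‖ ^ 2)) +
      ‖c * ((a * star a' + b * star b') / ((‖a'‖ ^ 2 + ‖b'‖ ^ 2 : ℝ) : 𝕜)) + d‖ ^ 2 *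
        (‖a'‖ ^ 2 + ‖b'‖ ^ 2) := by
  have hB : ((‖a'‖ ^ 2 + ‖b'‖ ^ 2 : ℝ) : 𝕜) ≠ 0 := by exact_mod_cast hβ.ne'
  have h2 : ((‖a'‖ ^ 2 + ‖b'‖ ^ 2 : ℝ) : 𝕜) = a' * star a' + b' * star b' := by
    push_cast
    rw [← RCLike.mul_conj, ← RCLike.mul_conj]; rfl
  have hstar : star ((‖a'‖ ^ 2 + ‖b'‖ ^ 2 : ℝ) : 𝕜) = ((‖a'‖ ^ 2 + ‖b'‖ ^ 2 : ℝ) : 𝕜) :=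
    RCLike.conj_ofReal _
  have e : ∀ z : 𝕜, ((‖z‖ : ℝ) : 𝕜) ^ 2 = z * star z := fun z => (RCLike.mul_conj z).symm
  have : (((‖c * a + d * a'‖ ^ 2 + ‖c * b + d * b'‖ ^ 2 : ℝ)) : 𝕜) =
      ((‖c‖ ^ 2 * (‖a * b' - b * a'‖ ^ 2 / (‖a'‖ ^ 2 + ‖b'‖ ^ 2)) +
      ‖c * ((a * star a' + b * star b') / ((‖a'‖ ^ 2 + ‖b'‖ ^ 2 : ℝ) : 𝕜)) + d‖ ^ 2 *
        (‖a'‖ ^ 2 + ‖b'‖ ^ 2) : ℝ) : 𝕜) := by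
    rw [RCLike.ofReal_add (_ * _), RCLike.ofReal_mul (_ ^ 2) (_ + _),
      RCLike.ofReal_mul (_ ^ 2) (_ / _), RCLike.ofReal_div]
    rw [RCLike.ofReal_add, RCLike.ofReal_pow, RCLike.ofReal_pow, RCLike.ofReal_pow,
      RCLike.ofReal_pow, RCLike.ofReal_pow]
    simp only [e]
    simp only [star_add, star_mul', star_sub, star_div₀, star_star, hstar]
    set B := ((‖a'‖ ^ 2 + ‖b'‖ ^ 2 : ℝ) : 𝕜)
    field_simp
    rw [h2]
    ring
  exact_mod_cast this

/-- Algebraic Iwasawa decomposition. -/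
theorem iwasawa_alg {A : Type*} [CommRing A] [StarRing A] (a b c d z w y : A) (hz : z * w = 1)
    (h1 : z * star z = c * star c + d * star d) (h2 : z ^ 2 * y = a * d - b * c) :
    ∃ x : A, ∃ k : Matrix (Fin 2) (Fin 2) A, k.conjTranspose * k = 1 ∧ k.det = 1 ∧
      !![a, b; c, d] = z • (Matrix.of ![![y, x], ![0, 1]] * k) := by
  have hsw : star z * star w = 1 := by rw [← star_mul', hz, star_one]
  have hb : (c * star c + d * star d) * (w * star w) = 1 := by
    rw [← h1]; linear_combination (star z * star w) * hz + hsw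
  refine ⟨(a * star (c * w) + b * star (d * w)) * w,
    !![star (d * w), - star (c * w); c * w, d * w], ?_, ?_, ?_⟩
  · ext i j
    fin_cases i <;> fin_cases j <;> simp [Matrix.mul_apply, Fin.sum_univ_two] <;>
      first | linear_combination hb | ring
  · simp [Matrix.det_fin_two]
    linear_combination hb
  · have hy : y = (a * d - b * c) * w ^ 2 := by
      rw [← h2]; linear_combination (-(z * w) * y - y) * hz
    ext i j
    fin_cases i <;> fin_cases j <;> simp [Matrix.mul_apply, Fin.sum_univ_two, hy]
    · linear_combination (-(a * z * w)) * hb - a * hz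
    · linear_combination (-(b * z * w)) * hb - b * hz
    · linear_combination (-c) * hz
    · linear_combination (-d) * hz

open scoped Classical in
theorem exists_sign (F : Type) [Field F] [NumberField F]
    (s : {w : InfinitePlace F // w.IsReal} → ℝ) (hs : ∀ w, s w = 1 ∨ s w = -1) :
    ∃ e : F, e ≠ 0 ∧ ∀ w, 0 < (mixedEmbedding F e).1 w * s w := by
  let b := mixedEmbedding.latticeBasis F
  set C := ∑ i, ‖b i‖ with hC
  have hC0 : 0 ≤ C := Finset.sum_nonneg fun i _ => norm_nonneg _
  let v : mixedEmbedding.mixedSpace F := (fun w => (C + 1) * s w, fun _ => ((C + 1 : ℝ) : ℂ))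
  have h1 : ‖ZSpan.fract b v‖ ≤ C := ZSpan.norm_fract_le b v
  have h2 : ((ZSpan.floor b v : Submodule.span ℤ (Set.range b)) : mixedEmbedding.mixedSpace F) ∈
      Submodule.span ℤ (Set.range b) := (ZSpan.floor b v).2
  rw [mixedEmbedding.mem_span_latticeBasis] at h2
  obtain ⟨o, ho⟩ := h2
  have ho' : mixedEmbedding F (o : F) =
    ((ZSpan.floor b v : Submodule.span ℤ (Set.range b)) : mixedEmbedding.mixedSpace F) := ho
  rw [ZSpan.fract_apply, ← ho', norm_prod_le_iff, pi_norm_le_iff_of_nonneg hC0,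
    pi_norm_le_iff_of_nonneg hC0] at h1
  have hr : ∀ w, 0 < (mixedEmbedding F (o : F)).1 w * s w := by
    intro w
    have := h1.1 w
    simp only [Prod.fst_sub, Pi.sub_apply, v, Real.norm_eq_abs, abs_le] at this
    rcases hs w with h | h <;> rw [h] at this ⊢ <;> linarith [this.1, this.2]
  refine ⟨(o : F), ?_, hr⟩
  intro h0
  rw [h0, map_zero] at hr h1
  obtain ⟨w⟩ : Nonempty (InfinitePlace F) := inferInstance
  rcases w.isReal_or_isComplex with hw | hw
  · simpa using hr ⟨w, hw⟩
  · have := h1.2 ⟨w, hw⟩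
    have h3 : (v - 0).2 ⟨w, hw⟩ = ((C + 1 : ℝ) : ℂ) := by rw [sub_zero]
    rw [h3, Complex.norm_real, Real.norm_eq_abs] at this
    rw [abs_of_pos (by linarith)] at this
    linarith

theorem mem_convexBodyLT_iff (F : Type) [Field F] [NumberField F] (f : InfinitePlace F → NNReal)
    (x : mixedEmbedding.mixedSpace F) :
    x ∈ mixedEmbedding.convexBodyLT F f ↔ ∀ w, mixedEmbedding.normAtPlace w x < f w := by
  constructor
  · intro h w
    rcases w.isReal_or_isComplex with hw | hw
    · rw [mixedEmbedding.normAtPlace_apply_of_isReal hw]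
      simpa using h.1 ⟨w, hw⟩ trivial
    · rw [mixedEmbedding.normAtPlace_apply_of_isComplex hw]
      simpa using h.2 ⟨w, hw⟩ trivial
  · intro h
    refine ⟨fun w _ => ?_, fun w _ => ?_⟩
    · have := h w.1
      rw [mixedEmbedding.normAtPlace_apply_of_isReal w.2] at this
      simpa using this
    · have := h w.1
      rw [mixedEmbedding.normAtPlace_apply_of_isComplex w.2] at this
      simpa using this

theorem isOpen_convexBodyLT (F : Type) [Field F] [NumberField F] (f : InfinitePlace F → NNReal) :
    IsOpen (mixedEmbedding.convexBodyLT F f) :=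
  (isOpen_set_pi Set.finite_univ fun _ _ => Metric.isOpen_ball).prod
    (isOpen_set_pi Set.finite_univ fun _ _ => Metric.isOpen_ball)

open MeasureTheory in
open scoped Classical in
theorem shear_measurePreserving (F : Type) [Field F] [NumberField F]
    (x : mixedEmbedding.mixedSpace F) :
    MeasurePreserving (fun p : mixedEmbedding.mixedSpace F × mixedEmbedding.mixedSpace F =>
      (p.1, p.1 * x + p.2)) volume volume := by
  refine MeasurePreserving.skew_product (g := fun a c => a * x + c) (MeasurePreserving.id _) ?_ ?_
  · have : Continuous (Function.uncurry fun a c : mixedEmbedding.mixedSpace F => a * x + c) := by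
      unfold Function.uncurry
      fun_prop
    exact this.measurable
  · exact Filter.Eventually.of_forall fun a => map_add_left_eq_self _ _

open MeasureTheory in
theorem mink2 (F : Type) [Field F] [NumberField F] :
    ∃ B : NNReal, 0 < B ∧ ∀ (x : mixedEmbedding.mixedSpace F) (t : InfinitePlace F → NNReal),
      (∀ w, 0 < t w) → ∃ c d : 𝓞 F, (c ≠ 0 ∨ d ≠ 0) ∧
        ∀ w : InfinitePlace F, mixedEmbedding.normAtPlace w (mixedEmbedding F (c : F)) < B * (t w)⁻¹ ∧
          mixedEmbedding.normAtPlace w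
            (mixedEmbedding F (c : F) * x + mixedEmbedding F (d : F)) < B * t w := by
  classical
  let b := (mixedEmbedding.latticeBasis F).prod (mixedEmbedding.latticeBasis F)
  set V : ENNReal := volume (ZSpan.fundamentalDomain b) *
    2 ^ Module.finrank ℝ (mixedEmbedding.mixedSpace F × mixedEmbedding.mixedSpace F) with hV
  have hVtop : V < ⊤ := ENNReal.mul_lt_top (ZSpan.fundamentalDomain_isBounded _).measure_lt_top <|
    ENNReal.pow_lt_top ENNReal.ofNat_lt_top
  refine ⟨V.toNNReal + 1, by positivity, ?_⟩
  set B : NNReal := V.toNNReal + 1 with hB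
  intro x t ht
  let f1 : InfinitePlace F → NNReal := fun w => B * (t w)⁻¹
  let f2 : InfinitePlace F → NNReal := fun w => B * t w
  let T : (mixedEmbedding.mixedSpace F × mixedEmbedding.mixedSpace F) →ₗ[ℝ]
      (mixedEmbedding.mixedSpace F × mixedEmbedding.mixedSpace F) :=
    LinearMap.prod (LinearMap.fst _ _ _)
      ((LinearMap.mulRight ℝ x) ∘ₗ (LinearMap.fst _ _ _) + LinearMap.snd _ _ _)
  have hT : ∀ p, T p = (p.1, p.1 * x + p.2) := fun p => rfl
  let S := T ⁻¹' (mixedEmbedding.convexBodyLT F f1 ×ˢ mixedEmbedding.convexBodyLT F f2)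
  have hvol : V < volume S := by
    have h1 : volume S = volume (mixedEmbedding.convexBodyLT F f1 ×ˢ
        mixedEmbedding.convexBodyLT F f2) :=
      (shear_measurePreserving F x).measure_preimage
        ((isOpen_convexBodyLT F f1).prod (isOpen_convexBodyLT F f2)).measurableSet.nullMeasurableSet
    rw [h1, Measure.volume_eq_prod, Measure.prod_prod, mixedEmbedding.convexBodyLT_volume,
      mixedEmbedding.convexBodyLT_volume]
    have h2 : (∏ w, f1 w ^ w.mult) * (∏ w, f2 w ^ w.mult) = (B ^ 2) ^ Module.finrank ℚ F := by
      rw [← Finset.prod_mul_distrib, ← InfinitePlace.sum_mult_eq, ← Finset.prod_pow_eq_pow_sum]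
      refine Finset.prod_congr rfl fun w _ => ?_
      rw [← mul_pow]
      congr 1
      have := (ht w).ne'
      simp only [f1, f2]
      field_simp
    have h3 : V < B := by
      rw [hB, ← ENNReal.coe_toNNReal hVtop.ne]
      exact_mod_cast lt_add_one _
    refine h3.trans_le ?_
    norm_cast
    have hf := mixedEmbedding.one_le_convexBodyLTFactor F
    have hB1 : 1 ≤ B := by rw [hB]; exact le_add_self
    calc B ≤ (B ^ 2) ^ Module.finrank ℚ F := by
          rw [← pow_mul]
          exact le_self_pow₀ hB1 (by have := Module.finrank_pos (R := ℚ) (M := F); positivity)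
      _ = 1 * (∏ w, f1 w ^ w.mult) * (1 * ∏ w, f2 w ^ w.mult) := by rw [← h2]; ring
      _ ≤ _ := by gcongr
  have hsymm : ∀ p ∈ S, -p ∈ S := by
    intro p hp
    simp only [S, Set.mem_preimage, map_neg] at hp ⊢
    exact ⟨mixedEmbedding.convexBodyLT_neg_mem F f1 _ hp.1,
      mixedEmbedding.convexBodyLT_neg_mem F f2 _ hp.2⟩
  have hconv : Convex ℝ S := ((mixedEmbedding.convexBodyLT_convex F f1).prod
    (mixedEmbedding.convexBodyLT_convex F f2)).linear_preimage T
  have hBorel : BorelSpace (mixedEmbedding.mixedSpace F × mixedEmbedding.mixedSpace F) :=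
    Prod.borelSpace
  have hHaar : (volume : Measure (mixedEmbedding.mixedSpace F × mixedEmbedding.mixedSpace F)).IsAddHaarMeasure :=
    MeasureTheory.Measure.prod.instIsAddHaarMeasure volume volume
  have h_fund := ZSpan.isAddFundamentalDomain' b volume
  have : Countable (Submodule.span ℤ (Set.range b)).toAddSubgroup := by
    change Countable (Submodule.span ℤ (Set.range b))
    infer_instance
  obtain ⟨⟨p, hp⟩, hp0, hpS⟩ := exists_ne_zero_mem_lattice_of_measure_mul_two_pow_lt_measure
    h_fund hsymm hconv hvol
  have hsub : ∀ q ∈ Submodule.span ℤ (Set.range b),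
      q.1 ∈ Submodule.span ℤ (Set.range (mixedEmbedding.latticeBasis F)) ∧
      q.2 ∈ Submodule.span ℤ (Set.range (mixedEmbedding.latticeBasis F)) := by
    intro q hq
    induction hq using Submodule.span_induction with
    | mem y hy =>
      obtain ⟨i, rfl⟩ := hy
      rcases i with i | i
      · simp only [b, Module.Basis.prod_apply, Sum.elim_inl, Function.comp, LinearMap.inl_apply]
        exact ⟨Submodule.subset_span ⟨i, rfl⟩, Submodule.zero_mem _⟩
      · simp only [b, Module.Basis.prod_apply, Sum.elim_inr, Function.comp, LinearMap.inr_apply]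
        exact ⟨Submodule.zero_mem _, Submodule.subset_span ⟨i, rfl⟩⟩
    | zero => exact ⟨Submodule.zero_mem _, Submodule.zero_mem _⟩
    | add y z _ _ hy hz => exact ⟨Submodule.add_mem _ hy.1 hz.1, Submodule.add_mem _ hy.2 hz.2⟩
    | smul a y _ hy => exact ⟨Submodule.smul_mem _ _ hy.1, Submodule.smul_mem _ _ hy.2⟩
  obtain ⟨hp1, hp2⟩ := hsub p hp
  rw [mixedEmbedding.mem_span_latticeBasis] at hp1 hp2
  obtain ⟨c, hc⟩ := hp1
  obtain ⟨d, hd⟩ := hp2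
  have hc' : mixedEmbedding F (c : F) = p.1 := hc
  have hd' : mixedEmbedding F (d : F) = p.2 := hd
  refine ⟨c, d, ?_, fun w => ?_⟩
  · by_contra! h
    apply hp0
    ext1
    change p = 0
    ext1
    · rw [← hc', h.1]; simp
    · rw [← hd', h.2]; simp
  · have h := hpS
    simp only [S, Set.mem_preimage, hT] at h
    rw [hc', hd']
    exact ⟨by simpa [f1] using (mem_convexBodyLT_iff F f1 _).1 h.1 w,
      by simpa [f2] using (mem_convexBodyLT_iff F f2 _).1 h.2 w⟩

open scoped nonZeroDivisors in
open MeasureTheory in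
theorem mink_ideal (F : Type) [Field F] [NumberField F] :
    ∃ B : NNReal, 0 < B ∧ ∀ J : Ideal (𝓞 F), J ≠ ⊥ → ∃ m : F, m ≠ 0 ∧
      m ∈ ((J : FractionalIdeal (𝓞 F)⁰ F)⁻¹) ∧ (∀ w : InfinitePlace F, w m ≤ B) ∧
      (|Algebra.norm ℚ m| : ℝ) * Ideal.absNorm J ≤ B := by
  classical
  set V : ENNReal := volume (ZSpan.fundamentalDomain (mixedEmbedding.latticeBasis F)) *
    2 ^ Module.finrank ℝ (mixedEmbedding.mixedSpace F) with hV
  have hVtop : V < ⊤ := ENNReal.mul_lt_top (ZSpan.fundamentalDomain_isBounded _).measure_lt_top <|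
    ENNReal.pow_lt_top ENNReal.ofNat_lt_top
  refine ⟨V.toNNReal + 1, by positivity, ?_⟩
  set B : NNReal := V.toNNReal + 1 with hB
  have hB1 : 1 ≤ B := by rw [hB]; exact le_add_self
  intro J hJ
  have hJ' : (J : FractionalIdeal (𝓞 F)⁰ F) ≠ 0 := FractionalIdeal.coeIdeal_ne_zero.mpr hJ
  let I : (FractionalIdeal (𝓞 F)⁰ F)ˣ := (Units.mk0 _ hJ')⁻¹
  have hI : (I : FractionalIdeal (𝓞 F)⁰ F) = (J : FractionalIdeal (𝓞 F)⁰ F)⁻¹ := by simp [I]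
  set N : ℕ := Ideal.absNorm J with hN
  have hN0 : 0 < N := Nat.pos_of_ne_zero (by rw [hN, Ne, Ideal.absNorm_eq_zero_iff]; exact hJ)
  have hn := Module.finrank_pos (R := ℚ) (M := F)
  set n := Module.finrank ℚ F with hn'
  set β : NNReal := (B / N) ^ ((n : ℝ)⁻¹) with hβ
  have hβn : β ^ n = B / N := by
    rw [hβ, ← NNReal.rpow_natCast, ← NNReal.rpow_mul, inv_mul_cancel₀ (by positivity),
      NNReal.rpow_one]
  have hprod : ∏ w : InfinitePlace F, β ^ w.mult = B / N := by
    rw [Finset.prod_pow_eq_pow_sum, InfinitePlace.sum_mult_eq, ← hn', hβn]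
  have hβB : β ≤ B := by
    have h1 : β ^ n ≤ B ^ n := by
      rw [hβn]
      calc B / N ≤ B := div_le_self zero_le (by exact_mod_cast hN0)
        _ ≤ B ^ n := le_self_pow₀ hB1 hn.ne'
    exact le_of_pow_le_pow_left₀ hn.ne' zero_le h1
  have hbound : mixedEmbedding.minkowskiBound F I <
      volume (mixedEmbedding.convexBodyLT F (fun _ => β)) := by
    rw [mixedEmbedding.minkowskiBound,
      mixedEmbedding.volume_fundamentalDomain_fractionalIdealLatticeBasis,
      mixedEmbedding.convexBodyLT_volume, hprod, hI, map_inv₀, FractionalIdeal.coeIdeal_absNorm,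
      mul_assoc, ← hV, ← hN]
    have h3 : V = (V.toNNReal : ENNReal) := (ENNReal.coe_toNNReal hVtop.ne).symm
    have h4 : ENNReal.ofReal (((N : ℚ)⁻¹ : ℚ) : ℝ) = (((N : NNReal)⁻¹ : NNReal) : ENNReal) := by
      rw [ENNReal.ofReal]
      congr 1
      ext
      simp
    rw [h4, h3]
    norm_cast
    have hf := mixedEmbedding.one_le_convexBodyLTFactor F
    calc (N : NNReal)⁻¹ * V.toNNReal < (N : NNReal)⁻¹ * B := by
          have : (0 : NNReal) < (N : NNReal)⁻¹ := by positivity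
          exact mul_lt_mul_of_pos_left (by rw [hB]; exact lt_add_one _) this
      _ = 1 * (B / N) := by rw [one_mul, div_eq_mul_inv, mul_comm]
      _ ≤ _ := by gcongr
  obtain ⟨m, hm, hm0, hmw⟩ := mixedEmbedding.exists_ne_zero_mem_ideal_lt F I hbound
  refine ⟨m, hm0, hI ▸ hm, fun w => (hmw w).le.trans (by exact_mod_cast hβB), ?_⟩
  have h5 := InfinitePlace.prod_eq_abs_norm m
  have h6 : ∏ w : InfinitePlace F, w m ^ w.mult ≤ ∏ w : InfinitePlace F, (β : ℝ) ^ w.mult :=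
    Finset.prod_le_prod (fun w _ => by positivity)
      fun w _ => pow_le_pow_left₀ (by positivity) (hmw w).le _
  have h7 : ∏ w : InfinitePlace F, (β : ℝ) ^ w.mult = B / N := by exact_mod_cast hprod
  rw [h7, h5] at h6
  have hNr : (0 : ℝ) < N := by exact_mod_cast hN0
  rw [le_div_iff₀ hNr] at h6
  push_cast at h6 ⊢
  exact h6

theorem span_mul_pair {R : Type*} [CommRing R] (m a b : R) :
    Ideal.span {m} * Ideal.span {a, b} = Ideal.span {m * a, m * b} := by
  rw [Ideal.span_insert, Ideal.mul_sup, Ideal.span_singleton_mul_span_singleton,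
    Ideal.span_singleton_mul_span_singleton, ← Ideal.span_insert]

theorem span_pair_ne_bot {R : Type*} [CommRing R] {a b : R} (h : a ≠ 0 ∨ b ≠ 0) :
    Ideal.span {a, b} ≠ ⊥ := by
  intro h0
  rw [Ideal.span_eq_bot] at h0
  rcases h with h | h
  · exact h (h0 a (by simp))
  · exact h (h0 b (by simp))

open scoped nonZeroDivisors in
theorem cusp_choice (F : Type) [Field F] [NumberField F] :
    ∃ P Q : ClassGroup (𝓞 F) → 𝓞 F, (∀ C, P C ≠ 0 ∨ Q C ≠ 0) ∧
      ∀ c d : 𝓞 F, (c ≠ 0 ∨ d ≠ 0) → ∃ (C : ClassGroup (𝓞 F)) (x y : 𝓞 F), x ≠ 0 ∧ y ≠ 0 ∧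
        Ideal.span {x} * Ideal.span {c, d} = Ideal.span {y} * Ideal.span {P C, Q C} := by
  have key : ∀ C : ClassGroup (𝓞 F), ∃ p q : 𝓞 F, (p ≠ 0 ∨ q ≠ 0) ∧
      ∀ I : (Ideal (𝓞 F))⁰, ClassGroup.mk0 I = C →
        (∃ c d : 𝓞 F, (I : Ideal (𝓞 F)) = Ideal.span {c, d}) →
        ∃ x y : 𝓞 F, x ≠ 0 ∧ y ≠ 0 ∧
        Ideal.span {x} * (I : Ideal (𝓞 F)) = Ideal.span {y} * Ideal.span {p, q} := by
    intro C
    by_cases h : ∃ I : (Ideal (𝓞 F))⁰, ClassGroup.mk0 I = C ∧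
        ∃ c d : 𝓞 F, (I : Ideal (𝓞 F)) = Ideal.span {c, d}
    · obtain ⟨I, hI, p, q, hpq⟩ := h
      refine ⟨p, q, ?_, ?_⟩
      · by_contra! h0
        apply nonZeroDivisors.coe_ne_zero I
        rw [hpq, h0.1, h0.2]
        simp
      · intro I' hI' _
        obtain ⟨x, y, hx, hy, hxy⟩ := ClassGroup.mk0_eq_mk0_iff.mp (hI'.trans hI.symm)
        exact ⟨x, y, hx, hy, by rw [hxy, hpq]⟩
    · exact ⟨1, 0, Or.inl one_ne_zero, fun I hI hcd => absurd ⟨I, hI, hcd⟩ h⟩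
  choose P Q hPQ hk using key
  refine ⟨P, Q, hPQ, fun c d hcd => ?_⟩
  let I : (Ideal (𝓞 F))⁰ := ⟨Ideal.span {c, d}, mem_nonZeroDivisors_of_ne_zero
    (span_pair_ne_bot hcd)⟩
  obtain ⟨x, y, hx, hy, hxy⟩ := hk (ClassGroup.mk0 I) I rfl ⟨c, d, rfl⟩
  exact ⟨ClassGroup.mk0 I, x, y, hx, hy, hxy⟩

open scoped nonZeroDivisors in
theorem cusp_reps (F : Type) [Field F] [NumberField F] :
    ∃ P Q : ClassGroup (𝓞 F) → 𝓞 F, (∀ C, P C ≠ 0 ∨ Q C ≠ 0) ∧ ∃ A : ℝ, 0 < A ∧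
      ∀ c d : 𝓞 F, (c ≠ 0 ∨ d ≠ 0) → ∃ (C : ClassGroup (𝓞 F))
        (γ : Matrix.SpecialLinearGroup (Fin 2) (𝓞 F)) (l : F),
        (∀ w : InfinitePlace F, w l ≤ A) ∧
        ((γ 0 0 * P C + γ 0 1 * Q C : 𝓞 F) : F) = l * (c : F) ∧
        ((γ 1 0 * P C + γ 1 1 * Q C : 𝓞 F) : F) = l * (d : F) := by
  obtain ⟨P, Q, hPQ, hch⟩ := cusp_choice F
  obtain ⟨B, hB, hm⟩ := mink_ideal F
  have key : ∀ J : Ideal (𝓞 F), ∃ x y : 𝓞 F, x ≠ 0 ∧ y ≠ 0 ∧ ∀ c d : 𝓞 F, (c ≠ 0 ∨ d ≠ 0) →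
      J = Ideal.span {c, d} → ∃ C, Ideal.span {x} * J = Ideal.span {y} * Ideal.span {P C, Q C} := by
    intro J
    by_cases h : ∃ c d : 𝓞 F, (c ≠ 0 ∨ d ≠ 0) ∧ J = Ideal.span {c, d}
    · obtain ⟨c, d, hcd, rfl⟩ := h
      obtain ⟨C, x, y, hx, hy, hxy⟩ := hch c d hcd
      exact ⟨x, y, hx, hy, fun _ _ _ _ => ⟨C, hxy⟩⟩
    · exact ⟨1, 1, one_ne_zero, one_ne_zero, fun c d hcd hJ => absurd ⟨c, d, hcd, hJ⟩ h⟩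
  choose X Y hX hY hXY using key
  have hfin : {J : Ideal (𝓞 F) | Ideal.absNorm J ≤ ⌊B⌋₊}.Finite :=
    Ideal.finite_setOfPred_absNorm_le _
  set A0 : ℝ := ∑ J ∈ hfin.toFinset, ∑ w : InfinitePlace F, w ((X J : F) / (Y J : F)) with hA0
  have hA0n : 0 ≤ A0 := Finset.sum_nonneg fun J _ => Finset.sum_nonneg fun w _ => apply_nonneg w _
  refine ⟨P, Q, hPQ, (A0 + 1) * B, by positivity, fun c d hcd => ?_⟩
  have hJ0 := span_pair_ne_bot hcd
  obtain ⟨m, hm0, hmem, hmw, hmN⟩ := hm _ hJ0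
  rw [FractionalIdeal.mem_inv_iff (FractionalIdeal.coeIdeal_ne_zero.mpr hJ0)] at hmem
  obtain ⟨c', hc'⟩ := (FractionalIdeal.mem_one_iff _).mp (hmem (c : F)
    (FractionalIdeal.mem_coeIdeal_of_mem _ (Ideal.subset_span (by simp))))
  obtain ⟨d', hd'⟩ := (FractionalIdeal.mem_one_iff _).mp (hmem (d : F)
    (FractionalIdeal.mem_coeIdeal_of_mem _ (Ideal.subset_span (by simp))))
  have hcd' : c' ≠ 0 ∨ d' ≠ 0 := by
    rcases hcd with h | h
    · left; rintro rfl
      rw [map_zero] at hc'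
      rcases mul_eq_zero.mp hc'.symm with h' | h'
      · exact hm0 h'
      · exact h (by exact_mod_cast h')
    · right; rintro rfl
      rw [map_zero] at hd'
      rcases mul_eq_zero.mp hd'.symm with h' | h'
      · exact hm0 h'
      · exact h (by exact_mod_cast h')
  set J : Ideal (𝓞 F) := Ideal.span {c', d'} with hJ
  -- norm bound
  have hJN : Ideal.absNorm J ≤ ⌊B⌋₊ := by
    apply Nat.le_floor
    obtain ⟨n, k, hk, hnk⟩ := IsFractionRing.div_surjective (A := 𝓞 F) m
    have hk0 : k ≠ 0 := nonZeroDivisors.ne_zero hk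
    have hk0' : algebraMap (𝓞 F) F k ≠ 0 := by simpa using hk0
    have e1 : k * c' = n * c := by
      apply FaithfulSMul.algebraMap_injective (𝓞 F) F
      rw [map_mul, map_mul, hc', ← hnk]
      field_simp
    have e2 : k * d' = n * d := by
      apply FaithfulSMul.algebraMap_injective (𝓞 F) F
      rw [map_mul, map_mul, hd', ← hnk]
      field_simp
    have e3 : Ideal.span {k} * J = Ideal.span {n} * Ideal.span {c, d} := by
      rw [hJ, span_mul_pair, span_mul_pair, e1, e2]
    have e4 := congrArg Ideal.absNorm e3
    rw [map_mul, map_mul, Ideal.absNorm_span_singleton, Ideal.absNorm_span_singleton] at e4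
    have e5 : ∀ o : 𝓞 F, (((Algebra.norm ℤ o).natAbs : ℕ) : ℝ) =
        ((|Algebra.norm ℚ (algebraMap (𝓞 F) F o)| : ℚ) : ℝ) := by
      intro o
      rw [show Algebra.norm ℚ (algebraMap (𝓞 F) F o) = ((Algebra.norm ℤ o : ℤ) : ℚ) from
        (Algebra.coe_norm_int o).symm]
      rw [Nat.cast_natAbs]
      push_cast
      rfl
    have e6 : ((|Algebra.norm ℚ (algebraMap (𝓞 F) F k)| : ℚ) : ℝ) * (Ideal.absNorm J : ℝ) =
        ((|Algebra.norm ℚ (algebraMap (𝓞 F) F n)| : ℚ) : ℝ) *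
          (Ideal.absNorm (Ideal.span {c, d}) : ℝ) := by
      rw [← e5, ← e5]; exact_mod_cast e4
    have e7 : ((|Algebra.norm ℚ (algebraMap (𝓞 F) F n)| : ℚ) : ℝ) =
        ((|Algebra.norm ℚ (algebraMap (𝓞 F) F k)| : ℚ) : ℝ) * ((|Algebra.norm ℚ m| : ℚ) : ℝ) := by
      rw [← Rat.cast_mul, ← abs_mul, ← map_mul, ← hnk]
      congr 4
      field_simp
    have e8 : ((|Algebra.norm ℚ (algebraMap (𝓞 F) F k)| : ℚ) : ℝ) ≠ 0 := by
      rw [Ne, Rat.cast_eq_zero, abs_eq_zero, Algebra.norm_eq_zero_iff]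
      exact hk0'
    rw [e7, mul_assoc] at e6
    have e9 := mul_left_cancel₀ e8 e6
    have : (Ideal.absNorm J : ℝ) ≤ B := by
      rw [e9]
      push_cast at hmN ⊢
      exact hmN
    exact_mod_cast this
  obtain ⟨C, hC⟩ := hXY J c' d' hcd' hJ
  have hsp : Ideal.span {Y J * P C, Y J * Q C} = Ideal.span {X J * c', X J * d'} := by
    rw [← span_mul_pair, ← span_mul_pair, ← hC]
  have hne : Ideal.span {Y J * P C, Y J * Q C} ≠ ⊥ := by
    apply span_pair_ne_bot
    rcases hPQ C with h | h
    · exact Or.inl (mul_ne_zero (hY J) h)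
    · exact Or.inr (mul_ne_zero (hY J) h)
  obtain ⟨e11, e12, e21, e22, hdet, h1, h2⟩ := sl2_transitive _ _ _ _ hsp hne
  have hY0 : algebraMap (𝓞 F) F (Y J) ≠ 0 := by simpa using hY J
  refine ⟨C, ⟨!![e11, e12; e21, e22], by rw [Matrix.det_fin_two_of]; exact hdet⟩,
    (X J : F) / (Y J : F) * m, ?_, ?_, ?_⟩
  · intro w
    rw [map_mul]
    have h3 : w ((X J : F) / (Y J : F)) ≤ A0 := by
      calc w ((X J : F) / (Y J : F)) ≤ ∑ w : InfinitePlace F, w ((X J : F) / (Y J : F)) :=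
            Finset.single_le_sum (f := fun w : InfinitePlace F => w ((X J : F) / (Y J : F)))
              (fun w _ => apply_nonneg w _) (Finset.mem_univ w)
        _ ≤ A0 := Finset.single_le_sum
            (f := fun J => ∑ w : InfinitePlace F, w ((X J : F) / (Y J : F)))
            (fun J _ => Finset.sum_nonneg fun w _ => apply_nonneg w _)
            (hfin.mem_toFinset.mpr hJN)
    exact mul_le_mul (by linarith) (hmw w) (apply_nonneg w _) (by linarith)
  · have := congrArg (algebraMap (𝓞 F) F) h1
    simp only [map_add, map_mul, hc'] at this
    change algebraMap (𝓞 F) F (e11 * P C + e12 * Q C) = _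
    rw [map_add, map_mul, map_mul]
    field_simp
    linear_combination this
  · have := congrArg (algebraMap (𝓞 F) F) h2
    simp only [map_add, map_mul, hd'] at this
    change algebraMap (𝓞 F) F (e21 * P C + e22 * Q C) = _
    rw [map_add, map_mul, map_mul]
    field_simp
    linear_combination this

open mixedEmbedding in
theorem gram_global (F : Type) [Field F] [NumberField F] (a b a' b' : mixedSpace F)
    (hβ : ∀ w : InfinitePlace F, 0 < normAtPlace w a' ^ 2 + normAtPlace w b' ^ 2) :
    ∃ x0 : mixedSpace F, ∀ (w : InfinitePlace F) (c d : mixedSpace F),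
      normAtPlace w (c * a + d * a') ^ 2 + normAtPlace w (c * b + d * b') ^ 2 =
        normAtPlace w c ^ 2 * (normAtPlace w (a * b' - b * a') ^ 2 /
          (normAtPlace w a' ^ 2 + normAtPlace w b' ^ 2)) +
        normAtPlace w (c * x0 + d) ^ 2 * (normAtPlace w a' ^ 2 + normAtPlace w b' ^ 2) := by
  refine ⟨(fun w => (a.1 w * star (a'.1 w) + b.1 w * star (b'.1 w)) /
      ((‖a'.1 w‖ ^ 2 + ‖b'.1 w‖ ^ 2 : ℝ)),
    fun w => (a.2 w * star (a'.2 w) + b.2 w * star (b'.2 w)) /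
      ((‖a'.2 w‖ ^ 2 + ‖b'.2 w‖ ^ 2 : ℝ) : ℂ)), fun w c d => ?_⟩
  have h := hβ w
  rcases w.isReal_or_isComplex with hw | hw
  · simp only [normAtPlace_apply_of_isReal hw] at h ⊢
    exact gram_local (𝕜 := ℝ) _ _ _ _ _ _ h
  · simp only [normAtPlace_apply_of_isComplex hw] at h ⊢
    exact gram_local (𝕜 := ℂ) _ _ _ _ _ _ h

open mixedEmbedding in
theorem row_pos (F : Type) [Field F] [NumberField F] (a b c d : mixedSpace F)
    (w : InfinitePlace F) (h : normAtPlace w (a * d - b * c) ≠ 0) :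
    0 < normAtPlace w c ^ 2 + normAtPlace w d ^ 2 := by
  by_contra! h0
  have hc : normAtPlace w c = 0 := by
    nlinarith [sq_nonneg (normAtPlace w c), sq_nonneg (normAtPlace w d)]
  have hd : normAtPlace w d = 0 := by
    nlinarith [sq_nonneg (normAtPlace w c), sq_nonneg (normAtPlace w d)]
  apply h
  rcases w.isReal_or_isComplex with hw | hw
  · simp only [normAtPlace_apply_of_isReal hw, norm_eq_zero] at hc hd ⊢
    simp [hc, hd]
  · simp only [normAtPlace_apply_of_isComplex hw, norm_eq_zero] at hc hd ⊢
    simp [hc, hd]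

open mixedEmbedding in
theorem short_vector (F : Type) [Field F] [NumberField F] :
    ∃ B : ℝ, 0 < B ∧ ∀ a b a' b' : mixedSpace F,
      (∀ w : InfinitePlace F, 0 < normAtPlace w (a * b' - b * a')) →
      ∃ c d : 𝓞 F, (c ≠ 0 ∨ d ≠ 0) ∧ ∀ w : InfinitePlace F,
        normAtPlace w (mixedEmbedding F (c : F) * a + mixedEmbedding F (d : F) * a') ^ 2 +
        normAtPlace w (mixedEmbedding F (c : F) * b + mixedEmbedding F (d : F) * b') ^ 2 ≤
          B * normAtPlace w (a * b' - b * a') := by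
  obtain ⟨B, hB, hm⟩ := mink2 F
  refine ⟨2 * (B : ℝ) ^ 2, by positivity, fun a b a' b' hD => ?_⟩
  have hβ := fun w => row_pos F a b a' b' w (hD w).ne'
  obtain ⟨x0, hx0⟩ := gram_global F a b a' b' hβ
  let t : InfinitePlace F → NNReal := fun w => NNReal.sqrt (Real.toNNReal
    (normAtPlace w (a * b' - b * a') / (normAtPlace w a' ^ 2 + normAtPlace w b' ^ 2)))
  have ht2 : ∀ w, (t w : ℝ) ^ 2 =
      normAtPlace w (a * b' - b * a') / (normAtPlace w a' ^ 2 + normAtPlace w b' ^ 2) := by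
    intro w
    have h1 := div_pos (hD w) (hβ w)
    simp only [t]
    rw [← NNReal.coe_pow, NNReal.sq_sqrt, Real.coe_toNNReal _ h1.le]
  have ht : ∀ w, 0 < t w := by
    intro w
    have h1 := div_pos (hD w) (hβ w)
    rw [← ht2] at h1
    exact pos_of_ne_zero fun h => by simp [h] at h1
  obtain ⟨c, d, hcd, hw⟩ := hm x0 t ht
  refine ⟨c, d, hcd, fun w => ?_⟩
  rw [hx0]
  obtain ⟨h1, h2⟩ := hw w
  have hb := hβ w
  have hd := hD w
  have htw := ht2 w
  have htp : (0 : ℝ) < t w := by exact_mod_cast ht w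
  set β := normAtPlace w a' ^ 2 + normAtPlace w b' ^ 2
  set D := normAtPlace w (a * b' - b * a')
  have h1' := pow_le_pow_left₀ (normAtPlace_nonneg w _) h1.le 2
  have h2' := pow_le_pow_left₀ (normAtPlace_nonneg w _) h2.le 2
  rw [mul_pow, htw] at h2'
  rw [mul_pow, NNReal.coe_inv, inv_pow, htw] at h1'
  calc _ ≤ ((B : ℝ) ^ 2 * (D / β)⁻¹) * (D ^ 2 / β) + ((B : ℝ) ^ 2 * (D / β)) * β := by
        gcongr
    _ = _ := by field_simp; ring

theorem cmpR_K (F : Type) [Field F] [NumberField F] (k : Matrix (Fin 2) (Fin 2) (Finfty F))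
    (hk1 : kᴴ * k = 1) (hk2 : k.det = 1) (w : {w : InfinitePlace F // w.IsReal}) :
    (cmpR k w)ᵀ * cmpR k w = 1 ∧ (cmpR k w).det = 1 := by
  constructor
  · ext i j
    have h := congrArg (fun M : Matrix (Fin 2) (Fin 2) (Finfty F) => (M i j).1 w) hk1
    simp only [Matrix.mul_apply, Fin.sum_univ_two, Matrix.conjTranspose_apply] at h
    rw [Matrix.mul_apply, Fin.sum_univ_two]
    refine Eq.trans ?_ (h.trans ?_)
    · rfl
    · by_cases hij : i = j
      · subst hij; rw [Matrix.one_apply_eq, Matrix.one_apply_eq]; rfl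
      · rw [Matrix.one_apply_ne hij, Matrix.one_apply_ne hij]; rfl
  · have := congrArg (fun M : Finfty F => M.1 w) hk2
    rw [Matrix.det_fin_two] at this ⊢
    exact this

theorem cmpC_K (F : Type) [Field F] [NumberField F] (k : Matrix (Fin 2) (Fin 2) (Finfty F))
    (hk1 : kᴴ * k = 1) (hk2 : k.det = 1) (w : {w : InfinitePlace F // w.IsComplex}) :
    (cmpC k w)ᴴ * cmpC k w = 1 ∧ (cmpC k w).det = 1 := by
  constructor
  · ext i j
    have h := congrArg (fun M : Matrix (Fin 2) (Fin 2) (Finfty F) => (M i j).2 w) hk1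
    simp only [Matrix.mul_apply, Fin.sum_univ_two, Matrix.conjTranspose_apply] at h
    rw [Matrix.mul_apply, Fin.sum_univ_two]
    refine Eq.trans ?_ (h.trans ?_)
    · rfl
    · by_cases hij : i = j
      · subst hij; rw [Matrix.one_apply_eq, Matrix.one_apply_eq]; rfl
      · rw [Matrix.one_apply_ne hij, Matrix.one_apply_ne hij]; rfl
  · have := congrArg (fun M : Finfty F => M.2 w) hk2
    rw [Matrix.det_fin_two] at this ⊢
    exact this

open mixedEmbedding in
theorem iwasawa_global (F : Type) [Field F] [NumberField F] (a b c d : Finfty F)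
    (hR : ∀ w, 0 < (a * d - b * c).1 w) (hC : ∀ w, (a * d - b * c).2 w ≠ 0) :
    ∃ (z : (Finfty F)ˣ) (x y : Finfty F) (k : GL (Fin 2) (Finfty F)), InKinfty k ∧
      (∀ w : {w : InfinitePlace F // w.IsReal}, y.1 w = normAtPlace w.1 (a * d - b * c) /
          (normAtPlace w.1 c ^ 2 + normAtPlace w.1 d ^ 2)) ∧
      (∀ w : {w : InfinitePlace F // w.IsComplex}, y.2 w = ((normAtPlace w.1 (a * d - b * c) /
          (normAtPlace w.1 c ^ 2 + normAtPlace w.1 d ^ 2) : ℝ) : ℂ)) ∧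
      !![a, b; c, d] = z.val • (Matrix.of ![![y, x], ![0, 1]] *
        (k : Matrix (Fin 2) (Fin 2) (Finfty F))) := by
  have hpR : ∀ w : {w : InfinitePlace F // w.IsReal},
      0 < normAtPlace w.1 c ^ 2 + normAtPlace w.1 d ^ 2 := fun w => row_pos F a b c d w.1 (by
    rw [normAtPlace_apply_of_isReal w.2, norm_ne_zero_iff]; exact (hR w).ne')
  have hpC : ∀ w : {w : InfinitePlace F // w.IsComplex},
      0 < normAtPlace w.1 c ^ 2 + normAtPlace w.1 d ^ 2 := fun w => row_pos F a b c d w.1 (by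
    rw [normAtPlace_apply_of_isComplex w.2, norm_ne_zero_iff]; exact hC w)
  simp only [fun w : {w : InfinitePlace F // w.IsReal} => normAtPlace_apply_of_isReal w.2,
    fun w : {w : InfinitePlace F // w.IsComplex} => normAtPlace_apply_of_isComplex w.2] at *
  have hsq : ∀ w : {w : InfinitePlace F // w.IsComplex}, ∃ ζ : ℂ, ζ ^ 2 =
      (a * d - b * c).2 w * (((‖c.2 w‖ ^ 2 + ‖d.2 w‖ ^ 2) / ‖(a * d - b * c).2 w‖ : ℝ) : ℂ) :=
    fun w => IsAlgClosed.exists_pow_nat_eq _ two_pos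
  choose ζ hζ using hsq
  have hζn : ∀ w, ‖ζ w‖ ^ 2 = ‖c.2 w‖ ^ 2 + ‖d.2 w‖ ^ 2 := by
    intro w
    have h1 := hpC w
    have h2 : 0 < ‖(a * d - b * c).2 w‖ := norm_pos_iff.mpr (hC w)
    rw [← norm_pow, hζ, norm_mul, Complex.norm_real, Real.norm_eq_abs,
      abs_of_pos (div_pos h1 h2)]
    field_simp
  have hζ0 : ∀ w, ζ w ≠ 0 := by
    intro w h
    have h1 := hpC w
    rw [← hζn, h] at h1
    simp at h1
  let z : Finfty F := (fun w => Real.sqrt (‖c.1 w‖ ^ 2 + ‖d.1 w‖ ^ 2), ζ)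
  let z' : Finfty F := (fun w => (Real.sqrt (‖c.1 w‖ ^ 2 + ‖d.1 w‖ ^ 2))⁻¹, fun w => (ζ w)⁻¹)
  let y : Finfty F := (fun w => ‖(a * d - b * c).1 w‖ / (‖c.1 w‖ ^ 2 + ‖d.1 w‖ ^ 2),
    fun w => ((‖(a * d - b * c).2 w‖ / (‖c.2 w‖ ^ 2 + ‖d.2 w‖ ^ 2) : ℝ) : ℂ))
  have hz : z * z' = 1 := by
    ext w
    · exact mul_inv_cancel₀ (Real.sqrt_pos.mpr (hpR w)).ne'
    · exact mul_inv_cancel₀ (hζ0 w)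
  have h1 : z * star z = c * star c + d * star d := by
    ext w
    · change Real.sqrt _ * Real.sqrt _ = c.1 w * c.1 w + d.1 w * d.1 w
      rw [Real.mul_self_sqrt (hpR w).le]
      simp only [Real.norm_eq_abs, sq_abs]
      ring
    · change ζ w * (starRingEnd ℂ) (ζ w) =
        c.2 w * (starRingEnd ℂ) (c.2 w) + d.2 w * (starRingEnd ℂ) (d.2 w)
      rw [Complex.mul_conj', Complex.mul_conj', Complex.mul_conj']
      exact_mod_cast hζn w
  have h2 : z ^ 2 * y = a * d - b * c := by
    ext w
    · change (Real.sqrt _) ^ 2 * (‖(a * d - b * c).1 w‖ / (‖c.1 w‖ ^ 2 + ‖d.1 w‖ ^ 2)) =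
        (a * d - b * c).1 w
      have h := hpR w
      rw [Real.sq_sqrt h.le, Real.norm_of_nonneg (hR w).le]
      field_simp
    · change ζ w ^ 2 * ((‖(a * d - b * c).2 w‖ / (‖c.2 w‖ ^ 2 + ‖d.2 w‖ ^ 2) : ℝ) : ℂ) =
        (a * d - b * c).2 w
      have h1 := hpC w
      have h2 : 0 < ‖(a * d - b * c).2 w‖ := norm_pos_iff.mpr (hC w)
      rw [hζ, mul_assoc, ← Complex.ofReal_mul]
      rw [div_mul_div_cancel₀ h2.ne', div_self h1.ne', Complex.ofReal_one, mul_one]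
  obtain ⟨x, k, hk1, hk2, hk3⟩ := iwasawa_alg a b c d z z' y hz h1 h2
  refine ⟨⟨z, z', hz, by rw [mul_comm]; exact hz⟩, x, y,
    Matrix.GeneralLinearGroup.mk'' k (by rw [hk2]; exact isUnit_one), ⟨fun w => ?_, fun w => ?_⟩,
    fun w => rfl, fun w => rfl, hk3⟩
  · exact cmpR_K F k hk1 hk2 w
  · exact cmpC_K F k hk1 hk2 w

theorem stmt6 (F : Type) [Field F] [NumberField F] :
    ∃ (a : Fin (2 ^ (Nat.card {w : InfinitePlace F // w.IsReal}) * classNumber F) →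
        GL (Fin 2) F) (δ : ℝ), 0 < δ ∧
      ∀ g : GL (Fin 2) (Finfty F),
        ∃ (j : Fin (2 ^ (Nat.card {w : InfinitePlace F // w.IsReal}) * classNumber F))
          (z : (Finfty F)ˣ) (γ : Matrix.SpecialLinearGroup (Fin 2) (𝓞 F))
          (k : GL (Fin 2) (Finfty F)) (x y : Finfty F),
          InKinfty k ∧
          (∀ w, δ < y.1 w) ∧
          (∀ w, (y.2 w).im = 0 ∧ δ < (y.2 w).re) ∧
          (g : Matrix (Fin 2) (Fin 2) (Finfty F)) =
            z.val •
              (((γ : Matrix (Fin 2) (Fin 2) (𝓞 F)).map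
                  (fun o => mixedEmbedding F (algebraMap (𝓞 F) F o))) *
                ((a j : Matrix (Fin 2) (Fin 2) F).map (mixedEmbedding F)) *
                Matrix.of ![![y, x], ![0, 1]] *
                (k : Matrix (Fin 2) (Fin 2) (Finfty F))) := by
  classical
  obtain ⟨P, Q, hPQ, A, hA, hcusp⟩ := cusp_reps F
  obtain ⟨B, hB, hshort⟩ := short_vector F
  have hsign : ∀ σ : {w : InfinitePlace F // w.IsReal} → Bool, ∃ e : F, e ≠ 0 ∧
      ∀ w, 0 < (mixedEmbedding F e).1 w * (if σ w then 1 else -1) := fun σ =>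
    exists_sign F (fun w => if σ w then 1 else -1) (fun w => by cases σ w <;> simp)
  choose e he0 hes using hsign
  have hmat : ∀ i : ({w : InfinitePlace F // w.IsReal} → Bool) × ClassGroup (𝓞 F),
      ∃ M : GL (Fin 2) F, M 0 0 = (P i.2 : F) ∧ M 1 0 = (Q i.2 : F) ∧
        M 0 0 * M 1 1 - M 0 1 * M 1 0 = e i.1 := by
    rintro ⟨σ, C⟩
    have hE := he0 σ
    have : ∃ r s : F, (P C : F) * s - r * (Q C : F) = e σ := by
      rcases hPQ C with h | h
      · have h' : (P C : F) ≠ 0 := by exact_mod_cast h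
        exact ⟨0, e σ / P C, by field_simp; ring⟩
      · have h' : (Q C : F) ≠ 0 := by exact_mod_cast h
        exact ⟨-e σ / Q C, 0, by field_simp; ring⟩
    obtain ⟨r, s, hrs⟩ := this
    refine ⟨Matrix.GeneralLinearGroup.mk'' !![(P C : F), r; (Q C : F), s] ?_, rfl, rfl, hrs⟩
    rw [Matrix.det_fin_two_of, hrs]
    exact isUnit_iff_ne_zero.mpr hE
  choose am ham0 ham1 hamd using hmat
  have hcard : Fintype.card (({w : InfinitePlace F // w.IsReal} → Bool) × ClassGroup (𝓞 F)) =
      2 ^ (Nat.card {w : InfinitePlace F // w.IsReal}) * classNumber F := by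
    rw [Fintype.card_prod, Fintype.card_fun, Fintype.card_bool, Nat.card_eq_fintype_card]
    congr 1
  let E := Fintype.equivFinOfCardEq hcard
  obtain ⟨p0, hp0⟩ := Finite.exists_min
    (fun p : ({w : InfinitePlace F // w.IsReal} → Bool) × InfinitePlace F => p.2 (e p.1))
  set η := p0.2 (e p0.1) with hη
  have hη0 : 0 < η := InfinitePlace.pos_iff.mpr (he0 _)
  refine ⟨fun j => am (E.symm j), η / (2 * (A ^ 2 * B)), by positivity, fun g => ?_⟩
  set G : Matrix (Fin 2) (Fin 2) (Finfty F) := (g : Matrix (Fin 2) (Fin 2) (Finfty F)) with hG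
  set D : Finfty F := G 0 0 * G 1 1 - G 0 1 * G 1 0 with hD
  have hDu : IsUnit D := by
    have := (Matrix.isUnit_iff_isUnit_det G).mp g.isUnit
    rwa [Matrix.det_fin_two] at this
  have hDw : ∀ w : InfinitePlace F, 0 < mixedEmbedding.normAtPlace w D := fun w =>
    lt_of_le_of_ne (mixedEmbedding.normAtPlace_nonneg w D)
      (hDu.map (mixedEmbedding.normAtPlace w)).ne_zero.symm
  obtain ⟨c, d, hcd, hbd⟩ := hshort (G 0 0) (G 0 1) (G 1 0) (G 1 1) hDw
  obtain ⟨C, γ, l, hl, h1, h2⟩ := hcusp d (-c) (by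
    rcases hcd with h | h
    · exact Or.inr (neg_ne_zero.mpr h)
    · exact Or.inl h)
  let σ : {w : InfinitePlace F // w.IsReal} → Bool := fun w => decide (0 < D.1 w)
  set i : ({w : InfinitePlace F // w.IsReal} → Bool) × ClassGroup (𝓞 F) := (σ, C) with hi
  set M := am i with hM
  have hM0 : M 0 0 = (P C : F) := ham0 i
  have hM1 : M 1 0 = (Q C : F) := ham1 i
  have hMd : M 0 0 * M 1 1 - M 0 1 * M 1 0 = e σ := hamd i
  let ι := mixedEmbedding F
  let p : F := (γ 0 0 : F) * M 0 0 + (γ 0 1 : F) * M 1 0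
  let r : F := (γ 0 0 : F) * M 0 1 + (γ 0 1 : F) * M 1 1
  let q : F := (γ 1 0 : F) * M 0 0 + (γ 1 1 : F) * M 1 0
  let s : F := (γ 1 0 : F) * M 0 1 + (γ 1 1 : F) * M 1 1
  have hγ : (γ 0 0 : F) * (γ 1 1 : F) - (γ 0 1 : F) * (γ 1 0 : F) = 1 := by
    have h := γ.det_coe
    rw [Matrix.det_fin_two] at h
    exact_mod_cast congrArg (algebraMap (𝓞 F) F) h
  have hdet : p * s - q * r = e σ := by
    simp only [p, q, r, s]
    linear_combination (M 0 0 * M 1 1 - M 0 1 * M 1 0) * hγ + hMd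
  have hp : p = l * (d : F) := by
    simp only [p, hM0, hM1]
    rw [← h1]; push_cast; ring
  have hq : -q = l * (c : F) := by
    simp only [q, hM0, hM1]
    push_cast at h2
    linear_combination -h2
  have hιdet : ι p * ι s - ι q * ι r = ι (e σ) := by
    rw [← hdet, map_sub, map_mul, map_mul]
  have hιq : ι q = - (ι l * ι (c : F)) := by
    rw [← map_mul, ← map_neg, ← hq, neg_neg]
  have hιp : ι p = ι l * ι (d : F) := by rw [← map_mul, ← hp]
  set a1 : Finfty F := ι s * G 0 0 - ι r * G 1 0 with ha1
  set b1 : Finfty F := ι s * G 0 1 - ι r * G 1 1 with hb1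
  set c1 : Finfty F := - ι q * G 0 0 + ι p * G 1 0 with hc1
  set d1 : Finfty F := - ι q * G 0 1 + ι p * G 1 1 with hd1
  have hD1 : a1 * d1 - b1 * c1 = ι (e σ) * D := by
    rw [← hιdet, ha1, hb1, hc1, hd1, hD]; ring
  have hc1' : c1 = ι l * (ι (c : F) * G 0 0 + ι (d : F) * G 1 0) := by
    rw [hc1, hιq, hιp]; ring
  have hd1' : d1 = ι l * (ι (c : F) * G 0 1 + ι (d : F) * G 1 1) := by
    rw [hd1, hιq, hιp]; ring
  have hnap : ∀ w : InfinitePlace F, mixedEmbedding.normAtPlace w (a1 * d1 - b1 * c1) =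
      w (e σ) * mixedEmbedding.normAtPlace w D := fun w => by
    rw [hD1, map_mul, mixedEmbedding.normAtPlace_apply]
  have hnap0 : ∀ w : InfinitePlace F, mixedEmbedding.normAtPlace w (a1 * d1 - b1 * c1) ≠ 0 :=
    fun w => by
      rw [hnap]
      exact (mul_pos (InfinitePlace.pos_iff.mpr (he0 σ)) (hDw w)).ne'
  have hlow : ∀ w : InfinitePlace F, η / (2 * (A ^ 2 * B)) <
      mixedEmbedding.normAtPlace w (a1 * d1 - b1 * c1) /
        (mixedEmbedding.normAtPlace w c1 ^ 2 + mixedEmbedding.normAtPlace w d1 ^ 2) := by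
    intro w
    have hrow := row_pos F a1 b1 c1 d1 w (hnap0 w)
    have hle : mixedEmbedding.normAtPlace w c1 ^ 2 + mixedEmbedding.normAtPlace w d1 ^ 2 ≤
        A ^ 2 * (B * mixedEmbedding.normAtPlace w D) := by
      rw [hc1', hd1', map_mul, map_mul, mixedEmbedding.normAtPlace_apply, mul_pow, mul_pow,
        ← mul_add]
      have := pow_le_pow_left₀ (apply_nonneg w l) (hl w) 2
      exact mul_le_mul this (hbd w) (by positivity) (by positivity)
    have hηw : η ≤ w (e σ) := hp0 (σ, w)
    have hd0 := hDw w
    rw [hnap, lt_div_iff₀ hrow]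
    calc _ ≤ η / (2 * (A ^ 2 * B)) * (A ^ 2 * (B * mixedEmbedding.normAtPlace w D)) := by gcongr
      _ = η * mixedEmbedding.normAtPlace w D / 2 := by field_simp
      _ < η * mixedEmbedding.normAtPlace w D := by
        have := mul_pos hη0 hd0
        linarith
      _ ≤ _ := by gcongr
  obtain ⟨z, x, y, k, hk, hyR, hyC, hdec⟩ := iwasawa_global F a1 b1 c1 d1 (by
      intro w
      have h3 : D.1 w ≠ 0 := by
        have := (hDw w.1).ne'
        rwa [mixedEmbedding.normAtPlace_apply_of_isReal w.2, norm_ne_zero_iff] at this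
      have h4 := hes σ w
      rw [hD1]
      change 0 < (mixedEmbedding F (e σ)).1 w * D.1 w
      by_cases h5 : 0 < D.1 w
      · simp only [σ, h5, decide_true, if_true, mul_one] at h4
        exact mul_pos h4 h5
      · have h6 : D.1 w < 0 := lt_of_le_of_ne (not_lt.mp h5) h3
        simp only [σ, h5, decide_false] at h4
        norm_num at h4
        exact mul_pos_of_neg_of_neg h4 h6)
    (by
      intro w
      have := hnap0 w.1
      rwa [mixedEmbedding.normAtPlace_apply_of_isComplex w.2, norm_ne_zero_iff] at this)
  let u : (Finfty F)ˣ := Units.map (mixedEmbedding F : F →* Finfty F) (Units.mk0 (e σ) (he0 σ))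
  have hu : (u : Finfty F) = ι (e σ) := rfl
  have huinv : (↑u⁻¹ : Finfty F) * ι (e σ) = 1 := by rw [← hu]; exact u.inv_mul
  refine ⟨E i, u⁻¹ * z, γ, k, x, y, hk, fun w => ?_, fun w => ?_, ?_⟩
  · rw [hyR]; exact hlow w.1
  · rw [hyC]; exact ⟨Complex.ofReal_im _, by rw [Complex.ofReal_re]; exact hlow w.1⟩
  · have hEi : am (E.symm (E i)) = M := by rw [Equiv.symm_apply_apply]
    have hMM : ((γ : Matrix (Fin 2) (Fin 2) (𝓞 F)).map
          (fun o => mixedEmbedding F (algebraMap (𝓞 F) F o))) *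
        ((M : Matrix (Fin 2) (Fin 2) F).map (mixedEmbedding F)) = !![ι p, ι r; ι q, ι s] := by
      simp only [p, q, r, s, map_add, map_mul]
      ext1 i j
      fin_cases i <;> fin_cases j <;> simp [Matrix.mul_apply, Fin.sum_univ_two, ι]
    beta_reduce
    rw [hEi, hMM, Units.val_mul, mul_smul, mul_assoc, ← Matrix.mul_smul, ← hdec]
    have e4 : ∀ t : Finfty F, t = (↑u⁻¹ : Finfty F) * ((ι p * ι s - ι q * ι r) * t) := fun t => by
      rw [hιdet, ← mul_assoc, huinv, one_mul]
    rw [Matrix.eta_fin_two G, Matrix.mul_fin_two, Matrix.smul_of]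
    ext1 i j
    fin_cases i <;> fin_cases j
    · refine (e4 (G 0 0)).trans ?_
      change _ = (↑u⁻¹ : Finfty F) * (ι p * a1 + ι r * c1)
      rw [ha1, hc1]; ring
    · refine (e4 (G 0 1)).trans ?_
      change _ = (↑u⁻¹ : Finfty F) * (ι p * b1 + ι r * d1)
      rw [hb1, hd1]; ring
    · refine (e4 (G 1 0)).trans ?_
      change _ = (↑u⁻¹ : Finfty F) * (ι q * a1 + ι s * c1)
      rw [ha1, hc1]; ring
    · refine (e4 (G 1 1)).trans ?_
      change _ = (↑u⁻¹ : Finfty F) * (ι q * b1 + ι s * d1)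
      rw [hb1, hd1]; ring
end

section
/- Let F be a number field with ring of integers 𝔬. For every ε > 0 there exists a constant C > 0 (depending only on F and ε) such that for all nonzero ideals 𝔮 and 𝔞 of 𝔬 there exist a nonzero ideal 𝔫 of 𝔬 and a totally positive element α ∈ F^× with: 𝔫 = α·𝔞 as fractional ideals (so 𝔫 is in the same narrow ideal class as 𝔞), 𝔫 is coprime to 𝔮 (i.e. 𝔫 + 𝔮 = 𝔬), and N(𝔫) ≤ C · N(𝔮)^ε. -/
open NumberField

lemma sieve_aux (n : ℕ) (T : Finset ℕ) : (∀ p ∈ T, p.Prime) →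
    ∀ R : ℕ → Finset ℕ, (∀ p ∈ T, (R p).card ≤ n ∧ ∀ s ∈ R p, s < p) → ∀ X : ℕ,
    |(((Finset.range X).filter (fun j => ∀ p ∈ T, j % p ∉ R p)).card : ℝ)
      - X * ∏ p ∈ T, (1 - ((R p).card : ℝ) / p)| ≤ ((n : ℝ) + 1) ^ T.card - 1 := by
  classical
  induction T using Finset.induction_on with
  | empty => intro _ R _ X; simp
  | insert p T hpT ih =>
    intro hT R hR X
    have hp : p.Prime := hT p (by simp)
    have hppos : (0:ℝ) < p := by exact_mod_cast hp.pos
    have hT' : ∀ q ∈ T, q.Prime := fun q hq => hT q (by simp [hq])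
    have hR' : ∀ q ∈ T, (R q).card ≤ n ∧ ∀ s ∈ R q, s < q := fun q hq => hR q (by simp [hq])
    obtain ⟨hRn, hRlt⟩ := hR p (by simp)
    set D : ℝ := ∏ q ∈ T, (1 - ((R q).card : ℝ) / q) with hD
    have hcardle : ∀ q ∈ T, (R q).card ≤ q := by
      intro q hq
      calc (R q).card ≤ (Finset.range q).card :=
            Finset.card_le_card (fun s hs => by simpa using (hR' q hq).2 s hs)
        _ = q := by simp
    have hfac : ∀ q ∈ T, 0 ≤ (1 - ((R q).card : ℝ) / q) ∧ (1 - ((R q).card : ℝ) / q) ≤ 1 := by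
      intro q hq
      have hq0 : (0:ℝ) < q := by exact_mod_cast (hT' q hq).pos
      have : ((R q).card : ℝ) / q ≤ 1 := by
        rw [div_le_one hq0]; exact_mod_cast hcardle q hq
      have h2 : 0 ≤ ((R q).card : ℝ) / q := by positivity
      constructor <;> linarith
    have hD0 : 0 ≤ D := Finset.prod_nonneg fun q hq => (hfac q hq).1
    have hD1 : D ≤ 1 := Finset.prod_le_one (fun q hq => (hfac q hq).1) (fun q hq => (hfac q hq).2)
    -- the fibre counts
    have key : ∀ r ∈ R p,
        |(((Finset.range X).filter (fun j => j % p = r ∧ ∀ q ∈ T, j % q ∉ R q)).card : ℝ)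
          - X * D / p| ≤ ((n : ℝ) + 1) ^ T.card := by
      intro r hr
      have hrp := hRlt r hr
      -- number of i with r + p i < X
      set Y : ℕ := (X + (p - 1 - r)) / p with hY
      have hYlt : ∀ i, i < Y ↔ r + p * i < X := by
        intro i
        rw [hY, Nat.lt_iff_add_one_le, Nat.le_div_iff_mul_le hp.pos, add_mul, mul_comm i p]
        omega
      let R' : ℕ → Finset ℕ := fun q => (Finset.range q).filter (fun s => (r + p * s) % q ∈ R q)
      have hcop : ∀ q ∈ T, Nat.Coprime q p := by
        intro q hq
        rw [Nat.coprime_primes (hT' q hq) hp]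
        rintro rfl; exact hpT hq
      have hR'card : ∀ q ∈ T, (R' q).card = (R q).card := by
        intro q hq
        have hq0 := (hT' q hq).pos
        have hinj : Set.InjOn (fun s => (r + p * s) % q) (Finset.range q : Set ℕ) := by
          intro a ha b hb hab
          simp at ha hb
          have h1 : r + p * a ≡ r + p * b [MOD q] := hab
          have h2 := Nat.ModEq.add_left_cancel' r h1
          have h3 := Nat.ModEq.cancel_left_of_coprime (hcop q hq) h2
          exact Nat.ModEq.eq_of_lt_of_lt h3 ha hb
        have himg : (Finset.range q).image (fun s => (r + p * s) % q) = Finset.range q := by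
          apply Finset.eq_of_subset_of_card_le
          · intro s hs
            simp only [Finset.mem_image, Finset.mem_range] at hs ⊢
            obtain ⟨a, _, rfl⟩ := hs
            exact Nat.mod_lt _ hq0
          · rw [Finset.card_image_of_injOn hinj]
        have : R q = (R' q).image (fun s => (r + p * s) % q) := by
          ext t
          simp only [R', Finset.mem_image, Finset.mem_filter, Finset.mem_range]
          constructor
          · intro ht
            have : t ∈ (Finset.range q).image (fun s => (r + p * s) % q) := by
              rw [himg]; simpa using (hR' q hq).2 t ht
            simp only [Finset.mem_image, Finset.mem_range] at this
            obtain ⟨a, ha, rfl⟩ := this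
            exact ⟨a, ⟨ha, ht⟩, rfl⟩
          · rintro ⟨a, ⟨_, h⟩, rfl⟩; exact h
        rw [this, Finset.card_image_of_injOn]
        exact hinj.mono (by intro s; simp +contextual [R'])
      have hcount : ((Finset.range X).filter (fun j => j % p = r ∧ ∀ q ∈ T, j % q ∉ R q)).card
          = ((Finset.range Y).filter (fun j => ∀ q ∈ T, j % q ∉ R' q)).card := by
        symm
        apply Finset.card_bij (fun i _ => r + p * i)
        · intro i hi
          simp only [Finset.mem_filter, Finset.mem_range] at hi ⊢
          refine ⟨(hYlt i).1 hi.1, ?_, ?_⟩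
          · simp [Nat.mod_eq_of_lt hrp]
          · intro q hq h
            apply hi.2 q hq
            simp only [R', Finset.mem_filter, Finset.mem_range]
            refine ⟨Nat.mod_lt _ (hT' q hq).pos, ?_⟩
            convert h using 1
            exact ((Nat.mod_modEq i q).mul_left p).add_left r
        · intro a _ b _ h
          have := Nat.add_left_cancel h
          exact Nat.eq_of_mul_eq_mul_left hp.pos this
        · intro j hj
          simp only [Finset.mem_filter, Finset.mem_range] at hj
          obtain ⟨hjX, hjr, hjT⟩ := hj
          have hjeq : r + p * (j / p) = j := by rw [← hjr]; exact Nat.mod_add_div j p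
          refine ⟨j / p, ?_, hjeq⟩
          simp only [Finset.mem_filter, Finset.mem_range]
          refine ⟨(hYlt _).2 (by rw [hjeq]; exact hjX), ?_⟩
          intro q hq h
          apply hjT q hq
          simp only [R', Finset.mem_filter, Finset.mem_range] at h
          convert h.2 using 1
          conv_lhs => rw [← hjeq]
          exact (((Nat.mod_modEq (j/p) q).mul_left p).add_left r).symm
      have hI := ih hT' R' (fun q hq => ⟨by rw [hR'card q hq]; exact (hR' q hq).1,
        fun s hs => by simp [R'] at hs; exact hs.1⟩) Y
      rw [← hcount] at hI
      have hprod : ∏ q ∈ T, (1 - ((R' q).card : ℝ) / q) = D :=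
        Finset.prod_congr rfl fun q hq => by rw [hR'card q hq]
      rw [hprod] at hI
      have hYX : |(Y : ℝ) - X / p| ≤ 1 := by
        have h1 : Y * p ≤ X + (p - 1 - r) := Nat.div_mul_le_self _ _
        have h2 : X + (p - 1 - r) < (Y + 1) * p := by
          have := Nat.lt_mul_div_succ (X + (p - 1 - r)) hp.pos
          rw [mul_comm]; exact this
        have h1' : Y * p ≤ X + p := by omega
        have h2' : X ≤ (Y + 1) * p := by omega
        have h1r : (Y : ℝ) * p ≤ X + p := by exact_mod_cast h1'
        have h2r : (X : ℝ) ≤ (Y + 1) * p := by exact_mod_cast h2'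
        rw [abs_le]
        constructor
        · have : (X : ℝ) / p ≤ Y + 1 := by rw [div_le_iff₀ hppos]; exact h2r
          linarith
        · have : (Y : ℝ) - 1 ≤ X / p := by rw [le_div_iff₀ hppos]; linarith
          linarith
      have hYD : |(Y : ℝ) * D - X * D / p| ≤ 1 := by
        have : (Y : ℝ) * D - X * D / p = (Y - X / p) * D := by ring
        rw [this, abs_mul, abs_of_nonneg hD0]
        calc _ ≤ (1:ℝ) * 1 := mul_le_mul hYX hD1 hD0 zero_le_one
          _ = 1 := one_mul 1
      rw [abs_le] at hI hYD ⊢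
      constructor <;> linarith [hI.1, hI.2, hYD.1, hYD.2]
    have hsplit : (((Finset.range X).filter (fun j => ∀ q ∈ T, j % q ∉ R q)).card : ℝ)
        = ((Finset.range X).filter (fun j => ∀ q ∈ insert p T, j % q ∉ R q)).card
          + ∑ r ∈ R p, (((Finset.range X).filter
              (fun j => j % p = r ∧ ∀ q ∈ T, j % q ∉ R q)).card : ℝ) := by
      have h1 : ((Finset.range X).filter (fun j => ∀ q ∈ T, j % q ∉ R q)).filter
          (fun j => ¬ j % p ∈ R p) =
          (Finset.range X).filter (fun j => ∀ q ∈ insert p T, j % q ∉ R q) := by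
        ext j; simp; tauto
      have h2 := Finset.card_filter_add_card_filter_not
        (s := (Finset.range X).filter (fun j => ∀ q ∈ T, j % q ∉ R q)) (fun j => j % p ∈ R p)
      rw [h1] at h2
      have h3 := Finset.card_eq_sum_card_fiberwise
        (s := ((Finset.range X).filter (fun j => ∀ q ∈ T, j % q ∉ R q)).filter
          (fun j => j % p ∈ R p)) (f := fun j => j % p) (t := R p)
        (by intro j hj; simp at hj; exact hj.2)
      have h4 : ∀ r ∈ R p, ((((Finset.range X).filter (fun j => ∀ q ∈ T, j % q ∉ R q)).filter
          (fun j => j % p ∈ R p)).filter (fun j => j % p = r)) =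
          (Finset.range X).filter (fun j => j % p = r ∧ ∀ q ∈ T, j % q ∉ R q) := by
        intro r hr
        ext j
        simp only [Finset.mem_filter]
        constructor
        · tauto
        · rintro ⟨a, b, c⟩
          exact ⟨⟨⟨a, c⟩, b ▸ hr⟩, b⟩
      rw [Finset.sum_congr rfl (fun r hr => by rw [h4 r hr])] at h3
      rw [← h2, h3]; push_cast; ring
    have hI := ih hT' R hR' X
    have hsum : |∑ r ∈ R p, ((((Finset.range X).filter
              (fun j => j % p = r ∧ ∀ q ∈ T, j % q ∉ R q)).card : ℝ) - X * D / p)|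
          ≤ n * ((n : ℝ) + 1) ^ T.card := by
      refine (Finset.abs_sum_le_sum_abs _ _).trans ((Finset.sum_le_sum key).trans ?_)
      rw [Finset.sum_const, nsmul_eq_mul]
      gcongr
    rw [Finset.sum_sub_distrib, Finset.sum_const, nsmul_eq_mul] at hsum
    rw [Finset.prod_insert hpT, Finset.card_insert_of_notMem hpT, pow_succ, ← hD]
    rw [hsplit] at hI
    have hexp : (X : ℝ) * ((1 - ((R p).card : ℝ) / p) * D)
      = X * D - (R p).card * (X * D / p) := by ring
    rw [hexp]
    rw [abs_le] at hI hsum ⊢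
    constructor <;> linarith [hI.1, hI.2, hsum.1, hsum.2]

lemma sieve_exists (n : ℕ) (T : Finset ℕ) (hT : ∀ p ∈ T, p.Prime) (hT2 : ∀ p ∈ T, 2 * n ≤ p)
    (R : ℕ → Finset ℕ) (hR : ∀ p ∈ T, (R p).card ≤ n ∧ ∀ s ∈ R p, s < p) :
    ∃ j < (2 * (n + 1)) ^ T.card, ∀ p ∈ T, j % p ∉ R p := by
  by_contra! hcon
  have h := sieve_aux n T hT R hR ((2 * (n + 1)) ^ T.card)
  have h0 : (Finset.range ((2 * (n + 1)) ^ T.card)).filter (fun j => ∀ p ∈ T, j % p ∉ R p) = ∅ := by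
    rw [Finset.filter_eq_empty_iff]
    intro j hj
    simp only [Finset.mem_range] at hj
    push Not
    exact hcon j hj
  rw [h0] at h
  have hprod : (1/2 : ℝ) ^ T.card ≤ ∏ p ∈ T, (1 - ((R p).card : ℝ) / p) := by
    rw [← Finset.prod_const]
    apply Finset.prod_le_prod
    · intros; norm_num
    · intro p hp
      have hp0 : (0:ℝ) < p := by exact_mod_cast (hT p hp).pos
      have h1 : (2:ℝ) * (R p).card ≤ p := by
        exact_mod_cast (Nat.mul_le_mul_left 2 (hR p hp).1).trans (hT2 p hp)
      have : ((R p).card : ℝ) / p ≤ 1/2 := by rw [div_le_iff₀ hp0]; linarith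
      linarith
  have h2 : ((n : ℝ) + 1) ^ T.card ≤
      (((2 * (n + 1)) ^ T.card : ℕ) : ℝ) * ∏ p ∈ T, (1 - ((R p).card : ℝ) / p) := by
    calc ((n : ℝ) + 1) ^ T.card = (((2 * (n + 1)) ^ T.card : ℕ) : ℝ) * (1/2 : ℝ) ^ T.card := by
          push_cast; rw [← mul_pow]; congr 1; ring
      _ ≤ _ := by gcongr
  rw [abs_le] at h
  simp only [Finset.card_empty, Nat.cast_zero] at h
  linarith [h.1]

lemma mem_mul_of_int {F : Type} [Field F] [NumberField F] {P c : Ideal (𝓞 F)} {p : ℕ}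
    {t : ℤ} (hpt : IsCoprime t (p : ℤ)) (hpP : (p : 𝓞 F) ∈ P) {y : 𝓞 F} (hy : y ∈ c)
    (h : (t : 𝓞 F) * y ∈ P * c) : y ∈ P * c := by
  obtain ⟨a, b, hab⟩ := hpt
  have h1 : ((a : 𝓞 F) * t + b * p) = 1 := by exact_mod_cast congrArg (Int.cast (R := 𝓞 F)) hab
  have h2 : y = (a : 𝓞 F) * ((t : 𝓞 F) * y) + b * (p * y) := by
    calc y = ((a : 𝓞 F) * t + b * p) * y := by rw [h1, one_mul]
      _ = _ := by ring
  rw [h2]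
  exact add_mem (Ideal.mul_mem_left _ _ h) (Ideal.mul_mem_left _ _ (Ideal.mul_mem_mul hpP hy))

lemma not_le_mul {F : Type} [Field F] [NumberField F] {P c : Ideal (𝓞 F)} (hP : P.IsPrime)
    (hc : c ≠ 0) : ¬ c ≤ P * c := by
  intro h
  have h1 : P * c = 1 * c := by
    rw [one_mul]; exact le_antisymm Ideal.mul_le_right h
  have := mul_right_cancel₀ hc h1
  exact hP.ne_top (by rw [this, Ideal.one_eq_top])

lemma card_over {F : Type} [Field F] [NumberField F] (p : ℕ) (hp : p.Prime) :
    ∃ S : Finset (Ideal (𝓞 F)), S.card ≤ Module.finrank ℚ F ∧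
      ∀ P : Ideal (𝓞 F), P.IsPrime → (p : 𝓞 F) ∈ P → P ∈ S := by
  have hpZ : Prime (p : ℤ) := Nat.prime_iff_prime_int.1 hp
  have hp0 : Ideal.span {(p : ℤ)} ≠ ⊥ := by simpa using hp.ne_zero
  have hpr : (Ideal.span {(p : ℤ)}).IsPrime := (Ideal.span_singleton_prime hpZ.ne_zero).2 hpZ
  have hmax : (Ideal.span {(p : ℤ)}).IsMaximal := hpr.isMaximal hp0
  refine ⟨IsDedekindDomain.primesOverFinset (Ideal.span {(p : ℤ)}) (𝓞 F),
    Ideal.card_primesOverFinset_le_finrank (𝓞 F) ℚ F hp0, ?_⟩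
  intro P hP hpP
  rw [IsDedekindDomain.mem_primesOverFinset_iff hp0]
  refine ⟨hP, ⟨?_⟩⟩
  apply hmax.eq_of_le (Ideal.IsPrime.ne_top (Ideal.IsPrime.under ℤ P))
  rw [Ideal.span_singleton_le_iff_mem, Ideal.mem_comap]
  simpa using hpP

lemma exists_pos_shift {F : Type} [Field F] [NumberField F] (u v : F)
    (hv : ∀ σ : F →+* ℝ, 0 < σ v) : ∃ k : ℕ, ∀ σ : F →+* ℝ, 0 < σ (u + k * v) := by
  classical
  have : Finite (F →+* ℝ) := Finite.of_injective (fun σ => (algebraMap ℝ ℂ).comp σ) (by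
    intro a b h
    ext x
    have := congrArg (fun f : F →+* ℂ => f x) h
    simpa using this)
  have hk : ∀ σ : F →+* ℝ, ∃ k : ℕ, - σ u < k * σ v := by
    intro σ
    obtain ⟨k, hk⟩ := exists_nat_gt (- σ u / σ v)
    exact ⟨k, by rwa [div_lt_iff₀ (hv σ)] at hk⟩
  choose k hk using hk
  obtain ⟨K, hK⟩ := (Set.finite_range k).bddAbove
  refine ⟨K, fun σ => ?_⟩
  have h1 : (k σ : ℝ) ≤ K := by exact_mod_cast hK ⟨σ, rfl⟩
  have h2 := mul_le_mul_of_nonneg_right h1 (hv σ).le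
  simp only [map_add, map_mul, map_natCast]
  linarith [hk σ]

lemma norm_bound {F : Type} [Field F] [NumberField F] (x y : 𝓞 F) :
    ∃ K : ℝ, 0 < K ∧ ∀ m : ℕ, (Ideal.absNorm (Ideal.span {x + m * y}) : ℝ) ≤
      K * ((m : ℝ) + 1) ^ Module.finrank ℚ F := by
  classical
  set H : ℝ := 1 + ∑ σ : F →ₐ[ℚ] ℂ, (‖σ x‖ + ‖σ y‖) with hH
  have hHσ : ∀ σ : F →ₐ[ℚ] ℂ, ‖σ x‖ + ‖σ y‖ ≤ H := by
    intro σ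
    have := Finset.single_le_sum (f := fun σ : F →ₐ[ℚ] ℂ => ‖σ x‖ + ‖σ y‖)
      (fun i _ => by positivity) (Finset.mem_univ σ)
    linarith
  have hH0 : 0 < H := by positivity
  refine ⟨H ^ Module.finrank ℚ F, by positivity, fun m => ?_⟩
  have h1 : (Ideal.absNorm (Ideal.span {x + m * y}) : ℝ)
      = ‖algebraMap ℚ ℂ (Algebra.norm ℚ ((x + m * y : 𝓞 F) : F))‖ := by
    rw [Ideal.absNorm_span_singleton, ← Algebra.coe_norm_int]
    simp [Nat.cast_natAbs]
  rw [h1, Algebra.norm_eq_prod_embeddings ℚ ℂ, norm_prod, ← mul_pow]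
  rw [← AlgHom.card ℚ F ℂ, ← Finset.card_univ, ← Finset.prod_const]
  apply Finset.prod_le_prod
  · intros; positivity
  · intro σ _
    simp only [map_add, map_mul, map_natCast]
    calc _ ≤ ‖σ x‖ + ‖(m : ℂ) * σ y‖ := norm_add_le _ _
      _ = ‖σ x‖ + m * ‖σ y‖ := by simp
      _ ≤ (‖σ x‖ + ‖σ y‖) * (m + 1) := by
        nlinarith [norm_nonneg (σ x), norm_nonneg (σ y), (Nat.cast_nonneg m : (0:ℝ) ≤ m)]
      _ ≤ _ := by gcongr; exact hHσ σ

lemma choose_xy {F : Type} [Field F] [NumberField F] (c : Ideal (𝓞 F)) (hc : c ≠ 0)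
    (δ : 𝓞 F) (hδ : δ ≠ 0) (M : ℕ) (hM : M ≠ 0) :
    ∃ x y : 𝓞 F, x ∈ c ∧ y ∈ c ∧ x ≠ 0 ∧ 
      (∀ σ : F →+* ℝ, 0 < σ (x * δ)) ∧ (∀ σ : F →+* ℝ, 0 < σ (y * δ)) ∧
      Ideal.span {(M : 𝓞 F)} * c ⊔ Ideal.span {x} = c ∧
      Ideal.span {x} ⊔ Ideal.span {y} = c := by
  have hMO : (M : 𝓞 F) ≠ 0 := by exact_mod_cast hM
  obtain ⟨x₀, hx₀⟩ := IsDedekindDomain.exists_sup_span_eq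
    (I := Ideal.span {(M : 𝓞 F)} * c) (J := c) Ideal.mul_le_right
    (mul_ne_zero (by simpa using hMO) hc)
  set Nc := Ideal.absNorm c with hNc
  have hNc0 : Nc ≠ 0 := by rw [hNc, Ne, Ideal.absNorm_eq_zero_iff]; exact hc
  have hNcc : (Nc : 𝓞 F) ∈ c := Ideal.absNorm_mem c
  have hx₀c : x₀ ∈ c := by
    rw [← hx₀]; exact Ideal.mem_sup_right (Ideal.mem_span_singleton_self x₀)
  have hδF : (δ : F) ≠ 0 := by simpa using hδ
  -- candidate x = x₀ + (k+1) M Nc δ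
  have hpos : ∀ σ : F →+* ℝ, 0 < σ ((M : F) * Nc * δ * δ) := by
    intro σ
    have h1 : σ (δ : F) ≠ 0 := by simpa using hδ
    have h2 : (0:ℝ) < M := by positivity
    have h3 : (0:ℝ) < Nc := by positivity
    simp only [map_mul, map_natCast, mul_assoc]
    have := mul_self_pos.2 h1
    positivity
  obtain ⟨k₀, hk₀⟩ := exists_pos_shift ((x₀ : F) * δ) _ hpos
  have hex : ∃ k : ℕ, (∀ σ : F →+* ℝ, 0 < σ ((x₀ : F) * δ + k * ((M : F) * Nc * δ * δ))) ∧
      x₀ + k * (M * (Nc * δ)) ≠ 0 := by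
    by_cases h : x₀ + k₀ * (M * (Nc * δ)) = 0
    · refine ⟨k₀ + 1, fun σ => ?_, ?_⟩
      · have h1 := hk₀ σ
        have h2 := hpos σ
        have : (x₀ : F) * δ + ((k₀ + 1 : ℕ) : F) * ((M : F) * Nc * δ * δ) =
          ((x₀ : F) * δ + k₀ * ((M : F) * Nc * δ * δ)) + (M : F) * Nc * δ * δ := by
          push_cast; ring
        rw [this, map_add]; linarith
      · have : x₀ + ((k₀ + 1 : ℕ) : 𝓞 F) * (M * (Nc * δ)) = M * (Nc * δ) := by
          calc _ = (x₀ + k₀ * (M * (Nc * δ))) + M * (Nc * δ) := by push_cast; ring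
            _ = _ := by rw [h, zero_add]
        rw [this]
        have : (Nc : 𝓞 F) ≠ 0 := by exact_mod_cast hNc0
        exact mul_ne_zero hMO (mul_ne_zero this hδ)
    · exact ⟨k₀, hk₀, h⟩
  obtain ⟨k, hkpos, hkne⟩ := hex
  set x := x₀ + k * (M * (Nc * δ)) with hx
  have hmemM : (k : 𝓞 F) * (M * (Nc * δ)) ∈ Ideal.span {(M : 𝓞 F)} * c :=
    Ideal.mul_mem_left _ _ (Ideal.mul_mem_mul (Ideal.mem_span_singleton_self _)
      (Ideal.mul_mem_right _ _ hNcc))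
  have hxc : x ∈ c := add_mem hx₀c (Ideal.mul_le_right hmemM)
  have hxpos : ∀ σ : F →+* ℝ, 0 < σ ((x : F) * δ) := by
    intro σ
    have := hkpos σ
    convert this using 2
    simp only [hx, map_add, map_mul, map_natCast]; ring
  obtain ⟨y₀, hy₀⟩ := IsDedekindDomain.exists_sup_span_eq
    (I := Ideal.span {x}) (J := c) ((Ideal.span_singleton_le_iff_mem c).2 hxc)
    (by simpa using hkne)
  obtain ⟨l, hl⟩ := exists_pos_shift ((y₀ : F) * δ) _ hxpos
  have hy₀c : y₀ ∈ c := by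
    rw [← hy₀]; exact Ideal.mem_sup_right (Ideal.mem_span_singleton_self _)
  refine ⟨x, y₀ + l * x, hxc, add_mem hy₀c (Ideal.mul_mem_left _ _ hxc), hkne, hxpos, ?_, ?_, ?_⟩
  · intro σ
    convert hl σ using 2
    simp only [map_add, map_mul, map_natCast]; ring
  · apply le_antisymm
    · exact sup_le Ideal.mul_le_right ((Ideal.span_singleton_le_iff_mem c).2 hxc)
    · conv_lhs => rw [← hx₀]
      refine sup_le le_sup_left ((Ideal.span_singleton_le_iff_mem _).2 ?_)
      have : x₀ = x - k * (M * (Nc * δ)) := by rw [hx]; ring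
      rw [this]
      exact sub_mem (Ideal.mem_sup_right (Ideal.mem_span_singleton_self _))
        (Ideal.mem_sup_left hmemM)
  · apply le_antisymm
    · exact sup_le ((Ideal.span_singleton_le_iff_mem c).2 hxc)
        ((Ideal.span_singleton_le_iff_mem c).2 (add_mem hy₀c (Ideal.mul_mem_left _ _ hxc)))
    · conv_lhs => rw [← hy₀]
      refine sup_le le_sup_left ((Ideal.span_singleton_le_iff_mem _).2 ?_)
      have : (y₀ + l * x) - l * x = y₀ := by ring
      refine (congrArg (· ∈ Ideal.span {x} ⊔ Ideal.span {y₀ + l * x}) this).mp ?_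
      exact sub_mem (Ideal.mem_sup_right (Ideal.mem_span_singleton_self _))
        (Ideal.mem_sup_left (Ideal.mul_mem_left _ _ (Ideal.mem_span_singleton_self _)))

lemma key_lemma {F : Type} [Field F] [NumberField F] (c : Ideal (𝓞 F)) (hc : c ≠ 0)
    (δ : 𝓞 F) (hδ : δ ≠ 0) (ε : ℝ) (hε : 0 < ε) :
    ∃ C : ℝ, 0 < C ∧ ∀ q : Ideal (𝓞 F), q ≠ 0 → ∃ (n : Ideal (𝓞 F)) (γ : 𝓞 F),
      γ ≠ 0 ∧ n * c = Ideal.span {γ} ∧ (∀ σ : F →+* ℝ, 0 < σ (γ * δ)) ∧ n ⊔ q = ⊤ ∧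
      (Ideal.absNorm n : ℝ) ≤ C * (Ideal.absNorm q : ℝ) ^ ε := by
  classical
  set D := Module.finrank ℚ F with hD
  set A : ℝ := ((2 * (D + 1) : ℕ) : ℝ) with hA
  have hA0 : 0 < A := by rw [hA]; positivity
  obtain ⟨B, hB⟩ := exists_nat_gt (max (2 * (D : ℝ)) (A ^ ((D : ℝ) / ε)))
  have hB1 : 2 * D ≤ B := by
    have : (2 * (D : ℝ)) < B := (le_max_left _ _).trans_lt hB
    exact_mod_cast this.le
  have hB2 : A ^ ((D : ℝ) / ε) ≤ B := ((le_max_right _ _).trans_lt hB).le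
  have hB3 : A ^ (D : ℝ) ≤ (B : ℝ) ^ ε := by
    calc A ^ (D : ℝ) = (A ^ ((D : ℝ) / ε)) ^ ε := by
          rw [← Real.rpow_mul hA0.le]; congr 1; field_simp
      _ ≤ _ := by gcongr
  set M := B.factorial with hM
  obtain ⟨x, y, hxc, hyc, hx0, hxpos, hypos, hMx, hxy⟩ :=
    choose_xy c hc δ hδ M (Nat.factorial_ne_zero B)
  obtain ⟨K, hK, hKb⟩ := norm_bound x ((M : 𝓞 F) * y)
  refine ⟨K, hK, fun q hq => ?_⟩
  set Q := Ideal.absNorm q with hQ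
  have hQ0 : Q ≠ 0 := by rw [hQ, Ne, Ideal.absNorm_eq_zero_iff]; exact hq
  set T := Q.primeFactors.filter (fun p => B < p) with hT
  have hTp : ∀ p ∈ T, p.Prime := fun p hp =>
    Nat.prime_of_mem_primeFactors (Finset.mem_filter.1 hp).1
  have hTB : ∀ p ∈ T, B < p := fun p hp => (Finset.mem_filter.1 hp).2
  let R : ℕ → Finset ℕ := fun p => (Finset.range p).filter
    (fun s => ∃ P : Ideal (𝓞 F), P.IsPrime ∧ (p : 𝓞 F) ∈ P ∧ x + s * (M * y) ∈ P * c)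
  have hnotboth : ∀ P : Ideal (𝓞 F), P.IsPrime → x ∈ P * c → y ∈ P * c → False := by
    intro P hP h1 h2
    apply not_le_mul hP hc
    conv_lhs => rw [← hxy]
    exact sup_le ((Ideal.span_singleton_le_iff_mem _).2 h1)
      ((Ideal.span_singleton_le_iff_mem _).2 h2)
  have hR : ∀ p ∈ T, (R p).card ≤ D ∧ ∀ s ∈ R p, s < p := by
    intro p hp
    refine ⟨?_, fun s hs => by simpa using (Finset.mem_filter.1 hs).1⟩
    obtain ⟨S, hS, hSmem⟩ := card_over (F := F) p (hTp p hp)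
    refine le_trans ?_ hS
    have hch : ∀ s : ℕ, ∃ P : Ideal (𝓞 F), s ∈ R p →
        (P.IsPrime ∧ (p : 𝓞 F) ∈ P ∧ x + s * (M * y) ∈ P * c) := by
      intro s
      by_cases hs : s ∈ R p
      · obtain ⟨P, hP⟩ := (Finset.mem_filter.1 hs).2
        exact ⟨P, fun _ => hP⟩
      · exact ⟨⊥, fun h => absurd h hs⟩
    choose f hf using hch
    apply Finset.card_le_card_of_injOn f
    · intro s hs
      exact hSmem _ (hf s hs).1 (hf s hs).2.1
    · intro s hs t ht hst
      by_contra hne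
      obtain ⟨hP, hpP, h1⟩ := hf s hs
      obtain ⟨-, -, h2⟩ := hf t ht
      rw [← hst] at h2
      have hsp : s < p := by simpa using (Finset.mem_filter.1 hs).1
      have htp : t < p := by simpa using (Finset.mem_filter.1 ht).1
      have hcop : IsCoprime (((s : ℤ) - t) * M) (p : ℤ) := by
        apply IsCoprime.mul_left
        · rw [isCoprime_comm, Prime.coprime_iff_not_dvd (Nat.prime_iff_prime_int.1 (hTp p hp))]
          intro hd
          have := Int.eq_zero_of_abs_lt_dvd hd (by rw [abs_lt]; omega)
          omega
        · rw [Nat.isCoprime_iff_coprime, Nat.coprime_comm, (hTp p hp).coprime_iff_not_dvd, hM,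
            (hTp p hp).dvd_factorial]
          have := hTB p hp
          omega
      have hy : y ∈ f s * c := by
        apply mem_mul_of_int hcop hpP hyc
        have := sub_mem h1 h2
        convert this using 1
        push_cast; ring
      refine hnotboth _ hP ?_ hy
      have : x = (x + s * (M * y)) - (s * M) * y := by ring
      rw [this]
      exact sub_mem h1 (Ideal.mul_mem_left _ _ hy)
  obtain ⟨m, hm, hmR⟩ := sieve_exists D T hTp (fun p hp => hB1.trans (hTB p hp).le) R hR
  set γ := x + m * (M * y) with hγ
  have hγc : γ ∈ c := add_mem hxc (Ideal.mul_mem_left _ _ (Ideal.mul_mem_left _ _ hyc))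
  have hγpos : ∀ σ : F →+* ℝ, 0 < σ ((γ : F) * δ) := by
    intro σ
    have h1 := hxpos σ
    have h2 := hypos σ
    have : (γ : F) * δ = x * δ + (m * M) * (y * δ) := by
      simp only [hγ, map_add, map_mul, map_natCast]; ring
    rw [this, map_add, map_mul σ ((m : F) * M)]
    have h3 : 0 ≤ σ ((m : F) * M) := by simp only [map_mul, map_natCast]; positivity
    have := mul_nonneg h3 h2.le
    linarith
  have hcop : ∀ P : Ideal (𝓞 F), P.IsPrime → q ≤ P → γ ∉ P * c := by
    intro P hP hqP hγP
    by_cases hMP : (M : 𝓞 F) ∈ P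
    · apply not_le_mul hP hc
      conv_lhs => rw [← hMx]
      refine sup_le (Ideal.mul_mono_left ((Ideal.span_singleton_le_iff_mem _).2 hMP)) ?_
      rw [Ideal.span_singleton_le_iff_mem]
      have : x = γ - m * (M * y) := by rw [hγ]; ring
      rw [this]
      exact sub_mem hγP (Ideal.mul_mem_left _ _ (Ideal.mul_mem_mul hMP hyc))
    · have hQP : (Q : 𝓞 F) ∈ P := hqP (Ideal.absNorm_mem q)
      have : ∃ p ∈ Q.primeFactors, (p : 𝓞 F) ∈ P := by
        rw [← Nat.prod_factorization_pow_eq_self hQ0, Finsupp.prod, Nat.cast_prod] at hQP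
        rw [hP.prod_mem_iff] at hQP
        obtain ⟨p, hp, hpP⟩ := hQP
        refine ⟨p, by simpa using hp, ?_⟩
        rw [Nat.cast_pow] at hpP
        exact hP.mem_of_pow_mem _ hpP
      obtain ⟨p, hpQ, hpP⟩ := this
      have hpp := Nat.prime_of_mem_primeFactors hpQ
      have hBp : B < p := by
        by_contra! hle
        apply hMP
        obtain ⟨d, hd⟩ := (hpp.dvd_factorial (n := B)).2 hle
        rw [hM, hd, Nat.cast_mul]
        exact Ideal.mul_mem_right _ _ hpP
      have hpT : p ∈ T := Finset.mem_filter.2 ⟨hpQ, hBp⟩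
      apply hmR p hpT
      refine Finset.mem_filter.2 ⟨by simpa using Nat.mod_lt _ hpp.pos, P, hP, hpP, ?_⟩
      have hdm : ((m % p : ℕ) : 𝓞 F) = m - p * (m / p : ℕ) := by
        rw [eq_sub_iff_add_eq]; exact_mod_cast Nat.mod_add_div m p
      have : x + ((m % p : ℕ) : 𝓞 F) * (M * y) = γ - ((m / p : ℕ) * M) * (p * y) := by
        rw [hdm, hγ]; ring
      rw [this]
      exact sub_mem hγP (Ideal.mul_mem_left _ _ (Ideal.mul_mem_mul hpP hyc))
  obtain ⟨n, hn⟩ := Ideal.dvd_iff_le.2 ((Ideal.span_singleton_le_iff_mem c).2 hγc)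
  have hγnP : n ⊔ q = ⊤ := by
    by_contra hne
    obtain ⟨P, hPmax, hPle⟩ := Ideal.exists_le_maximal _ hne
    apply hcop P hPmax.isPrime (le_sup_right.trans hPle)
    rw [← Ideal.span_singleton_le_iff_mem, hn, mul_comm]
    exact Ideal.mul_mono_left (le_sup_left.trans hPle)
  have hγ0 : γ ≠ 0 := by
    intro h0
    have hqtop : q = ⊤ := by
      by_contra hne
      obtain ⟨P, hPmax, hPle⟩ := Ideal.exists_le_maximal _ hne
      apply hcop P hPmax.isPrime hPle
      rw [h0]; exact zero_mem _
    have hQ1 : Q = 1 := by rw [hQ, hqtop]; exact Ideal.absNorm_top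
    have hT0 : T = ∅ := by rw [hT, hQ1]; simp
    rw [hT0] at hm
    simp only [Finset.card_empty, pow_zero, Nat.lt_one_iff] at hm
    rw [hγ, hm] at h0
    apply hx0
    simpa using h0
  refine ⟨n, γ, hγ0, by rw [hn, mul_comm], hγpos, hγnP, ?_⟩
  have hnle : Ideal.absNorm n ≤ Ideal.absNorm (Ideal.span {γ}) := by
    rw [hn, map_mul]
    apply Nat.le_mul_of_pos_left
    rw [Nat.pos_iff_ne_zero, Ne, Ideal.absNorm_eq_zero_iff]; exact hc
  have hBQ : B ^ T.card ≤ Q := by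
    calc B ^ T.card = ∏ p ∈ T, B := by rw [Finset.prod_const]
      _ ≤ ∏ p ∈ T, p := Finset.prod_le_prod' (fun p hp => (hTB p hp).le)
      _ ≤ Q := Nat.le_of_dvd (Nat.pos_of_ne_zero hQ0)
          ((Finset.prod_dvd_prod_of_subset _ _ _ (Finset.filter_subset _ _)).trans
            (Nat.prod_primeFactors_dvd Q))
  calc (Ideal.absNorm n : ℝ) ≤ Ideal.absNorm (Ideal.span {γ}) := by exact_mod_cast hnle
    _ ≤ K * ((m : ℝ) + 1) ^ D := hKb m
    _ ≤ K * (A ^ T.card) ^ D := by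
      gcongr
      rw [hA]; exact_mod_cast hm
    _ = K * (A ^ (D : ℝ)) ^ T.card := by
      rw [Real.rpow_natCast, ← pow_mul, ← pow_mul, mul_comm T.card]
    _ ≤ K * ((B : ℝ) ^ ε) ^ T.card := by gcongr
    _ = K * ((B : ℝ) ^ T.card) ^ ε := by
      rw [← Real.rpow_natCast, ← Real.rpow_mul (by positivity), mul_comm ε,
        Real.rpow_mul (by positivity), Real.rpow_natCast]
    _ ≤ K * (Q : ℝ) ^ ε := by
      gcongr
      exact_mod_cast hBQ

theorem stmt13 (F : Type) [Field F] [NumberField F] :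
    ∀ ε : ℝ, 0 < ε →
      ∃ C : ℝ, 0 < C ∧
        ∀ q a : Ideal (𝓞 F), q ≠ 0 → a ≠ 0 →
          ∃ (n : Ideal (𝓞 F)) (α : F), n ≠ 0 ∧ α ≠ 0 ∧
            (∀ σ : F →+* ℝ, 0 < σ α) ∧
            (n : FractionalIdeal (nonZeroDivisors (𝓞 F)) F) =
              FractionalIdeal.spanSingleton (nonZeroDivisors (𝓞 F)) α *
                (a : FractionalIdeal (nonZeroDivisors (𝓞 F)) F) ∧
            n ⊔ q = ⊤ ∧
            (Ideal.absNorm n : ℝ) ≤ C * (Ideal.absNorm q : ℝ) ^ ε := by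
  classical
  intro ε hε
  have hfin : Finite (F →+* ℝ) := Finite.of_injective (fun σ => (algebraMap ℝ ℂ).comp σ) (by
    intro a b h
    ext x
    have := congrArg (fun f : F →+* ℂ => f x) h
    simpa using this)
  -- representatives of the inverse classes
  let rep : ClassGroup (𝓞 F) → nonZeroDivisors (Ideal (𝓞 F)) := fun k =>
    (ClassGroup.mk0_surjective k).choose
  have hrep : ∀ k, ClassGroup.mk0 (rep k) = k := fun k => (ClassGroup.mk0_surjective k).choose_spec
  have hrep0 : ∀ k, ((rep k : Ideal (𝓞 F))) ≠ 0 := fun k => nonZeroDivisors.coe_ne_zero _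
  -- keys
  let Key := ClassGroup (𝓞 F) × ((F →+* ℝ) → Prop)
  let good : Key → 𝓞 F → Prop := fun k δ => δ ≠ 0 ∧ ∀ σ : F →+* ℝ, k.2 σ ↔ 0 < σ δ
  have hC : ∀ k : Key, ∃ C : ℝ, 0 < C ∧ ∀ δ, good k δ → ∀ q : Ideal (𝓞 F), q ≠ 0 →
      ∃ (n : Ideal (𝓞 F)) (γ : 𝓞 F),
      γ ≠ 0 ∧ n * (rep k.1 : Ideal (𝓞 F)) = Ideal.span {γ} ∧
      (∀ σ : F →+* ℝ, 0 < σ (γ * δ)) ∧ n ⊔ q = ⊤ ∧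
      (Ideal.absNorm n : ℝ) ≤ C * (Ideal.absNorm q : ℝ) ^ ε := by
    intro k
    by_cases hk : ∃ δ, good k δ
    · obtain ⟨δ₀, hδ₀, hs₀⟩ := hk
      obtain ⟨C, hC0, hC⟩ := key_lemma (rep k.1 : Ideal (𝓞 F)) (hrep0 _) δ₀ hδ₀ ε hε
      refine ⟨C, hC0, fun δ hδ q hq => ?_⟩
      obtain ⟨n, γ, h1, h2, h3, h4, h5⟩ := hC q hq
      refine ⟨n, γ, h1, h2, fun σ => ?_, h4, h5⟩
      have h6 := h3 σ
      have h7 : 0 < σ δ₀ ↔ 0 < σ δ := (hs₀ σ).symm.trans (hδ.2 σ)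
      have h8 : σ (δ₀ : F) ≠ 0 := by simpa using hδ₀
      have h9 : σ (δ : F) ≠ 0 := by simpa using hδ.1
      rw [map_mul] at h6 ⊢
      rcases lt_or_gt_of_ne h8 with h | h
      · have h10 : σ (δ : F) < 0 := by
          rcases lt_or_gt_of_ne h9 with h' | h'
          · exact h'
          · exact absurd (h7.2 h') (not_lt.2 h.le)
        have : σ (γ : F) < 0 := by
          by_contra! hcon
          have := mul_nonpos_of_nonneg_of_nonpos hcon h.le
          linarith
        exact mul_pos_of_neg_of_neg this h10
      · exact mul_pos (pos_of_mul_pos_left h6 h.le) (h7.1 h)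
    · exact ⟨1, one_pos, fun δ hδ => absurd ⟨δ, hδ⟩ hk⟩
  choose Cf hCf0 hCf using hC
  have : Finite Key := inferInstanceAs (Finite (ClassGroup (𝓞 F) × ((F →+* ℝ) → Prop)))
  obtain ⟨C, hCub⟩ := (Set.finite_range Cf).bddAbove
  refine ⟨max C 1, by positivity, fun q a hq ha => ?_⟩
  let a' : nonZeroDivisors (Ideal (𝓞 F)) := ⟨a, mem_nonZeroDivisors_of_ne_zero ha⟩
  obtain ⟨δ, hδ0, hδ⟩ := ClassGroup.mk0_eq_mk0_inv_iff.1 (hrep (ClassGroup.mk0 a')⁻¹)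
  let k : Key := ((ClassGroup.mk0 a')⁻¹, fun σ => 0 < σ δ)
  obtain ⟨n, γ, h1, h2, h3, h4, h5⟩ := hCf k δ ⟨hδ0, fun σ => Iff.rfl⟩ q hq
  have hδF : (δ : F) ≠ 0 := by simpa using hδ0
  have hγF : (γ : F) ≠ 0 := by simpa using h1
  refine ⟨n, (γ : F) / δ, ?_, div_ne_zero hγF hδF, fun σ => ?_, ?_, h4, ?_⟩
  · rintro rfl
    rw [zero_mul] at h2
    exact h1 (Ideal.span_singleton_eq_bot.1 h2.symm)
  · have := h3 σ
    have h9 : σ (δ : F) ≠ 0 := by simpa using hδ0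
    have h10 : (γ : F) / δ = (γ * δ) / (δ * δ) := by field_simp
    rw [h10, map_div₀]
    apply div_pos this
    rw [map_mul]
    exact mul_self_pos.2 h9
  · have hc : ((rep k.1 : Ideal (𝓞 F)) : FractionalIdeal (nonZeroDivisors (𝓞 F)) F) ≠ 0 := by
      simpa using hrep0 k.1
    apply mul_right_cancel₀ hc
    have e1 := congrArg (fun I : Ideal (𝓞 F) =>
      (I : FractionalIdeal (nonZeroDivisors (𝓞 F)) F)) h2
    have e2 := congrArg (fun I : Ideal (𝓞 F) =>
      (I : FractionalIdeal (nonZeroDivisors (𝓞 F)) F)) hδ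
    simp only [FractionalIdeal.coeIdeal_mul, FractionalIdeal.coeIdeal_span_singleton] at e1 e2
    rw [e1, mul_assoc, mul_comm (a : FractionalIdeal (nonZeroDivisors (𝓞 F)) F)]
    change _ = _ * (((rep (ClassGroup.mk0 a')⁻¹ : Ideal (𝓞 F)) :
      FractionalIdeal (nonZeroDivisors (𝓞 F)) F) * ((a' : Ideal (𝓞 F)) :
      FractionalIdeal (nonZeroDivisors (𝓞 F)) F))
    rw [e2, FractionalIdeal.spanSingleton_mul_spanSingleton, div_mul_cancel₀ _ hδF]
  · refine h5.trans ?_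
    gcongr
    exact (hCub ⟨k, rfl⟩).trans (le_max_left _ _)
end
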